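/- arXiv:2511.01457 — 12 statements merged into one kernel-verified Lean document; each statement's English description precedes it below -/
import Mathlib

section
/- Let n, m, S, T, N be positive integers. Let A ∈ ℝ^{n×S}, B ∈ ℝ^{n×m}, and let U₀ ∈ ℝ^{m×T}, Z₀ ∈ ℝ^{S×T}, X₁ ∈ ℝ^{n×T} satisfy X₁ = A·Z₀ + B·U₀. Suppose K_i ∈ ℝ^{m×S} and G_i ∈ ℝ^{T×S}, for i = 1,…,N, satisfy U₀·G_i = K_i and Z₀·G_i = I_S. Let α₁,…,α_N : ℝⁿ → ℝ satisfy α_i(x) ≥ 0 for all i and Σ_{i=1}^N α_i(x) = 1, for every x ∈ ℝⁿ. Then for every x ∈ ℝⁿ, A + B·(Σ_{i=1}^N α_i(x) K_i) = X₁·(Σ_{i=1}^N α_i(x) G_i); consequently, for every function Z : ℝⁿ → ℝ^S and every x ∈ ℝⁿ, (A + B·K(x))·Z(x) = X₁·G(x)·Z(x), where K(x) := Σ_{i=1}^N α_i(x) K_i and G(x) := Σ_{i=1}^N α_i(x) G_i. -/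
open Matrix

/-- Data-based representation of the closed-loop nonlinear system
`x_{t+1} = (A + B K(x_t)) Z(x_t)` (Lemma 1 of the paper). -/
theorem stmt0 (n m S T N : ℕ) (hn : 0 < n) (hm : 0 < m) (hS : 0 < S) (hT : 0 < T)
    (hN : 0 < N)
    (A : Matrix (Fin n) (Fin S) ℝ) (B : Matrix (Fin n) (Fin m) ℝ)
    (U₀ : Matrix (Fin m) (Fin T) ℝ) (Z₀ : Matrix (Fin S) (Fin T) ℝ)
    (X₁ : Matrix (Fin n) (Fin T) ℝ)
    (hdata : X₁ = A * Z₀ + B * U₀)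
    (K : Fin N → Matrix (Fin m) (Fin S) ℝ) (G : Fin N → Matrix (Fin T) (Fin S) ℝ)
    (hUG : ∀ i, U₀ * G i = K i) (hZG : ∀ i, Z₀ * G i = 1)
    (α : Fin N → (Fin n → ℝ) → ℝ)
    (hα0 : ∀ i x, 0 ≤ α i x) (hα1 : ∀ x, ∑ i, α i x = 1) :
    (∀ x : Fin n → ℝ, A + B * (∑ i, α i x • K i) = X₁ * (∑ i, α i x • G i)) ∧
    (∀ (Z : (Fin n → ℝ) → Fin S → ℝ) (x : Fin n → ℝ),
      (A + B * (∑ i, α i x • K i)) *ᵥ Z x = (X₁ * (∑ i, α i x • G i)) *ᵥ Z x) := by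
  have key : ∀ x : Fin n → ℝ, A + B * (∑ i, α i x • K i) = X₁ * (∑ i, α i x • G i) := by
    intro x
    have hZ : Z₀ * (∑ i, α i x • G i) = 1 := by
      simp only [Matrix.mul_sum, Matrix.mul_smul, hZG, ← Finset.sum_smul, hα1, one_smul]
    have hU : U₀ * (∑ i, α i x • G i) = ∑ i, α i x • K i := by
      simp only [Matrix.mul_sum, Matrix.mul_smul, hUG]
    rw [hdata, Matrix.add_mul, Matrix.mul_assoc, Matrix.mul_assoc, hZ, hU, Matrix.mul_one]
  exact ⟨key, fun Z x => by rw [key x]⟩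
end

section
/- Let r be a positive integer and let Ā, F, G, Q, Q′ ∈ ℝ^{r×r} with Q and Q′ symmetric. If the 2r×2r block matrix [[Ā·F + Fᵀ·Āᵀ + Q′, Ā·G + Fᵀ], [Gᵀ·Āᵀ + F, G + Gᵀ − Q]] is positive definite, then Q′ − Ā·Q·Āᵀ is positive definite. -/
open Matrix

/-- Positive definiteness of the dilated block LMI implies the covariance-type
Lyapunov decrease condition `Q' - Ā Q Āᵀ ≻ 0`. -/
theorem stmt3 (r : ℕ) (hr : 0 < r)
    (Abar F G Q Q' : Matrix (Fin r) (Fin r) ℝ)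
    (hQ : Q.IsSymm) (hQ' : Q'.IsSymm)
    (h : (Matrix.fromBlocks (Abar * F + Fᵀ * Abarᵀ + Q') (Abar * G + Fᵀ)
        (Gᵀ * Abarᵀ + F) (G + Gᵀ - Q)).PosDef) :
    (Q' - Abar * Q * Abarᵀ).PosDef := by
  have hinj : Function.Injective (fromCols (1 : Matrix (Fin r) (Fin r) ℝ) (-Abar)).vecMul := by
    intro x y hxy
    ext i
    simpa [vecMul_fromCols] using congrFun hxy (Sum.inl i)
  have hpd := h.mul_mul_conjTranspose_same hinj
  rw [conjTranspose_eq_transpose_of_trivial, transpose_fromCols, fromCols_mul_fromBlocks,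
    fromCols_mul_fromRows] at hpd
  convert hpd using 1
  simp only [transpose_one, transpose_neg]
  noncomm_ring
end

section
/- Let r be a positive integer, let Q₁, Q₂ ∈ ℝ^{r×r} be symmetric positive definite, and let Ā ∈ ℝ^{r×r} be arbitrary. Then Q₂ − Ā·Q₁·Āᵀ is positive definite if and only if Q₁⁻¹ − Āᵀ·Q₂⁻¹·Ā is positive definite. -/
open Matrix

namespace Matrix

variable {m n : Type*} [Fintype m] [Fintype n] [DecidableEq m] [DecidableEq n]

/-- The two Schur complements of a symmetric block matrix with positive definite diagonal blocks
are simultaneously positive definite. -/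
theorem PosDef.schurComplement_iff {A : Matrix m m ℝ} {D : Matrix n n ℝ}
    (B : Matrix m n ℝ) (hA : A.PosDef) (hD : D.PosDef) :
    (D - Bᴴ * A⁻¹ * B).PosDef ↔ (A - B * D⁻¹ * Bᴴ).PosDef := by
  have : Invertible A := hA.isUnit.invertible
  have : Invertible D := hD.isUnit.invertible
  have h_semi : (D - Bᴴ * A⁻¹ * B).PosSemidef ↔ (A - B * D⁻¹ * Bᴴ).PosSemidef :=
    (PosDef.fromBlocks₁₁ B D hA).symm.trans (PosDef.fromBlocks₂₂ A B hD)
  have h_det : A.det * (D - Bᴴ * A⁻¹ * B).det = D.det * (A - B * D⁻¹ * Bᴴ).det := by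
    simpa only [invOf_eq_nonsing_inv] using
      (det_fromBlocks₁₁ A B Bᴴ D).symm.trans (det_fromBlocks₂₂ A B Bᴴ D)
  have h_unit : IsUnit (D - Bᴴ * A⁻¹ * B) ↔ IsUnit (A - B * D⁻¹ * Bᴴ) := by
    simp only [isUnit_iff_isUnit_det, isUnit_iff_ne_zero]
    rw [← mul_ne_zero_iff_left hA.det_pos.ne', h_det, mul_ne_zero_iff_left hD.det_pos.ne']
  constructor
  · intro h
    exact (h_semi.1 h.posSemidef).posDef_iff_isUnit.2 (h_unit.1 h.isUnit)
  · intro h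
    exact (h_semi.2 h.posSemidef).posDef_iff_isUnit.2 (h_unit.2 h.isUnit)

end Matrix

/-- Double Schur complement: `Q₂ - Ā Q₁ Āᵀ ≻ 0 ↔ Q₁⁻¹ - Āᵀ Q₂⁻¹ Ā ≻ 0`. -/
theorem stmt4 (r : ℕ) (hr : 0 < r)
    (Q₁ Q₂ Abar : Matrix (Fin r) (Fin r) ℝ)
    (h₁ : Q₁.PosDef) (h₂ : Q₂.PosDef) :
    (Q₂ - Abar * Q₁ * Abarᵀ).PosDef ↔ (Q₁⁻¹ - Abarᵀ * Q₂⁻¹ * Abar).PosDef := by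
  have h := PosDef.schurComplement_iff Abarᵀ h₁.inv h₂
  rwa [nonsing_inv_nonsing_inv _ ((isUnit_iff_isUnit_det _).1 h₁.isUnit),
    conjTranspose_eq_transpose_of_trivial, transpose_transpose] at h
end

section
/- Let r, N, p be positive integers and let D ⊆ ℝ^p. Let Q₁,…,Q_N ∈ ℝ^{r×r} be symmetric positive definite, let F, G ∈ ℝ^{r×r}, let Ā : D → ℝ^{r×r} be any function, and let α₁,…,α_N : D → ℝ satisfy α_i(ρ) ≥ 0 and Σ_{i=1}^N α_i(ρ) = 1 for all ρ ∈ D. Suppose that for every ρ ∈ D and every pair (i,j) ∈ {1,…,N}², the 2r×2r block matrix [[Ā(ρ)·F + Fᵀ·Ā(ρ)ᵀ + Q_j, Ā(ρ)·G + Fᵀ], [Gᵀ·Ā(ρ)ᵀ + F, G + Gᵀ − Q_i]] is positive definite. Then, defining P(ρ) := Σ_{i=1}^N α_i(ρ)·Q_i⁻¹, the matrix P(ρ) − Ā(ρ)ᵀ·P(ρ′)·Ā(ρ) is positive definite for all ρ, ρ′ ∈ D. -/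
open Matrix

namespace Matrix

/-- A convex combination of positive definite matrices is positive definite. -/
theorem PosDef.sum_smul_of_sum_eq_one {n ι : Type*} [Fintype ι]
    {M : ι → Matrix n n ℝ} (hM : ∀ i, (M i).PosDef) {w : ι → ℝ} (hw0 : ∀ i, 0 ≤ w i) (hw1 : ∑ i, w i = 1) :
    (∑ i, w i • M i).PosDef := by
  classical
  obtain ⟨k, hk⟩ : ∃ k, 0 < w k := by
    by_contra! hneg
    have := Finset.sum_nonpos fun i (_ : i ∈ Finset.univ) => hneg i
    linarith
  rw [← Finset.add_sum_erase _ _ (Finset.mem_univ k)]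
  exact ((hM k).smul hk).add_posSemidef
    (posSemidef_sum _ fun i _ => (hM i).posSemidef.smul (hw0 i))

/-- If `R - A Q Aᵀ` is positive definite, then so is `Q⁻¹ - Aᵀ R⁻¹ A`. -/
theorem PosDef.inv_sub_transpose_mul_inv_mul {n m : Type*} [Fintype n] [Fintype m]
    [DecidableEq n] [DecidableEq m]
    {Q : Matrix n n ℝ} {R : Matrix m m ℝ} {A : Matrix m n ℝ}
    (hQ : Q.PosDef) (hR : R.PosDef) (h : (R - A * Q * Aᵀ).PosDef) :
    (Q⁻¹ - Aᵀ * R⁻¹ * A).PosDef := by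
  have hQt : Qᵀ = Q := by simpa using hQ.isHermitian.eq
  have hRt : Rᵀ = R := by simpa using hR.isHermitian.eq
  have hQu : IsUnit Q.det := (isUnit_iff_isUnit_det Q).1 hQ.isUnit
  have hRu : IsUnit R.det := (isUnit_iff_isUnit_det R).1 hR.isUnit
  set S := Aᵀ * R⁻¹ * A with hS
  set M := R⁻¹ * A with hM
  have hMt : Mᵀ = Aᵀ * R⁻¹ := by simp [hM, transpose_nonsing_inv, hRt]
  have hSt : (Q⁻¹ - S)ᵀ = Q⁻¹ - S := by
    simp [hS, transpose_nonsing_inv, hRt, hQt, Matrix.mul_assoc]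
  have hMR : Mᵀ * R * M = S := by
    rw [hMt, hM, hS, Matrix.mul_assoc Aᵀ, nonsing_inv_mul _ hRu, Matrix.mul_one,
      Matrix.mul_assoc]
  have hMA : Mᵀ * A = S := by rw [hMt]
  have hAM : Aᵀ * M = S := by rw [hM, hS, Matrix.mul_assoc]
  have key : Q⁻¹ - S = (Q⁻¹ - S)ᵀ * Q * (Q⁻¹ - S) + Mᵀ * (R - A * Q * Aᵀ) * M := by
    have h1 : Mᵀ * (R - A * Q * Aᵀ) * M = S - S * Q * S := by
      rw [Matrix.mul_sub, Matrix.sub_mul, hMR]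
      congr 1
      calc Mᵀ * (A * Q * Aᵀ) * M = (Mᵀ * A) * Q * (Aᵀ * M) := by
            simp only [Matrix.mul_assoc]
        _ = S * Q * S := by rw [hMA, hAM]
    rw [h1, hSt, Matrix.sub_mul, nonsing_inv_mul _ hQu, Matrix.sub_mul,
      Matrix.mul_sub (S * Q), Matrix.mul_assoc S Q Q⁻¹, mul_nonsing_inv _ hQu]
    simp
  have hquad (v : n → ℝ) : v ⬝ᵥ ((Q⁻¹ - S) *ᵥ v) =
      ((Q⁻¹ - S) *ᵥ v) ⬝ᵥ (Q *ᵥ ((Q⁻¹ - S) *ᵥ v)) +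
        (M *ᵥ v) ⬝ᵥ ((R - A * Q * Aᵀ) *ᵥ (M *ᵥ v)) := by
    conv_lhs => rw [key]
    simp only [add_mulVec, dotProduct_add, ← mulVec_mulVec, dotProduct_mulVec v,
      vecMul_transpose]
  refine PosDef.of_dotProduct_mulVec_pos (by simpa [IsHermitian] using hSt) fun v hv => ?_
  rw [star_trivial, hquad]
  have hnonneg := hQ.posSemidef.dotProduct_mulVec_nonneg ((Q⁻¹ - S) *ᵥ v)
  rw [star_trivial] at hnonneg
  by_cases hMv : M *ᵥ v = 0
  · have hSv : (Q⁻¹ - S) *ᵥ v = Q⁻¹ *ᵥ v := by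
      rw [sub_mulVec, ← hAM, ← mulVec_mulVec, hMv, mulVec_zero, sub_zero]
    have hne : (Q⁻¹ - S) *ᵥ v ≠ 0 := by
      rw [hSv]
      intro h0
      apply hv
      rw [← one_mulVec v, ← mul_nonsing_inv _ hQu, ← mulVec_mulVec, h0, mulVec_zero]
    have hpos := hQ.dotProduct_mulVec_pos hne
    rw [star_trivial] at hpos
    simpa [hMv] using hpos
  · have hpos := h.dotProduct_mulVec_pos hMv
    rw [star_trivial] at hpos
    linarith

/-- Eliminating the slack matrices `F` and `G` by compressing along `(1, -Aᵀ)`. -/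
theorem PosDef.sub_mul_mul_transpose_of_fromBlocks {n : Type*} [Fintype n]
    {A F G Q R : Matrix n n ℝ}
    (hQ : Q.PosDef) (hR : R.PosDef)
    (h : (fromBlocks (A * F + Fᵀ * Aᵀ + R) (A * G + Fᵀ)
      (Gᵀ * Aᵀ + F) (G + Gᵀ - Q)).PosDef) :
    (R - A * Q * Aᵀ).PosDef := by
  have hQt : Qᵀ = Q := by simpa using hQ.isHermitian.eq
  have hRt : Rᵀ = R := by simpa using hR.isHermitian.eq
  refine PosDef.of_dotProduct_mulVec_pos
    (by simp [IsHermitian, hQt, hRt, Matrix.mul_assoc]) fun x hx => ?_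
  have hne : Sum.elim x (-(Aᵀ *ᵥ x)) ≠ 0 := fun h0 =>
    hx (funext fun i => congrFun h0 (Sum.inl i))
  have hpos := h.dotProduct_mulVec_pos hne
  rw [star_trivial, fromBlocks_mulVec, sumElim_dotProduct_sumElim] at hpos
  have hA (y : n → ℝ) : (Aᵀ *ᵥ x) ⬝ᵥ y = x ⬝ᵥ (A *ᵥ y) := by
    rw [mulVec_transpose, dotProduct_mulVec]
  simp only [Sum.elim_comp_inl, Sum.elim_comp_inr, mulVec_neg, neg_dotProduct, hA,
    add_mulVec, sub_mulVec, dotProduct_add, dotProduct_sub,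
    dotProduct_neg, ← mulVec_mulVec] at hpos
  rw [star_trivial]
  simp only [sub_mulVec, dotProduct_sub, ← mulVec_mulVec]
  linarith

end Matrix

/-- Feasibility of the vertex LMIs yields the parameter-dependent Lyapunov function
`P(ρ) = Σ_i α_i(ρ) Q_i⁻¹` for the polytopic LPV system `η_{t+1} = Ā(ρ_t) η_t`. -/
theorem stmt6 (r N p : ℕ) (hr : 0 < r) (hN : 0 < N) (hp : 0 < p)
    (D : Set (Fin p → ℝ))
    (Q : Fin N → Matrix (Fin r) (Fin r) ℝ) (hQ : ∀ i, (Q i).PosDef)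
    (F G : Matrix (Fin r) (Fin r) ℝ)
    (Abar : (Fin p → ℝ) → Matrix (Fin r) (Fin r) ℝ)
    (α : Fin N → (Fin p → ℝ) → ℝ)
    (hα0 : ∀ i, ∀ ρ ∈ D, 0 ≤ α i ρ) (hα1 : ∀ ρ ∈ D, ∑ i, α i ρ = 1)
    (h : ∀ ρ ∈ D, ∀ i j : Fin N,
      (Matrix.fromBlocks
        (Abar ρ * F + Fᵀ * (Abar ρ)ᵀ + Q j) (Abar ρ * G + Fᵀ)
        (Gᵀ * (Abar ρ)ᵀ + F) (G + Gᵀ - Q i)).PosDef) :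
    ∀ ρ ∈ D, ∀ ρ' ∈ D,
      ((∑ i, α i ρ • (Q i)⁻¹) - (Abar ρ)ᵀ * (∑ i, α i ρ' • (Q i)⁻¹) * Abar ρ).PosDef := by
  intro ρ hρ ρ' hρ'
  have hvertex (i j : Fin N) : ((Q i)⁻¹ - (Abar ρ)ᵀ * (Q j)⁻¹ * Abar ρ).PosDef :=
    (hQ i).inv_sub_transpose_mul_inv_mul (hQ j)
      ((hQ i).sub_mul_mul_transpose_of_fromBlocks (hQ j) (h ρ hρ i j))
  have hcomb := PosDef.sum_smul_of_sum_eq_one (fun i =>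
    PosDef.sum_smul_of_sum_eq_one (hvertex i) (fun j => hα0 j ρ' hρ') (hα1 ρ' hρ'))
    (fun i => hα0 i ρ hρ) (hα1 ρ hρ)
  convert hcomb using 1
  simp only [smul_sub, Finset.sum_sub_distrib, ← Finset.sum_smul, hα1 ρ hρ, hα1 ρ' hρ',
    one_smul, Matrix.mul_sum, Matrix.sum_mul, Matrix.mul_smul, Matrix.smul_mul]
end

section
/- Let n ≥ 1 and d ≥ 2 be integers. Let S be the number of multi-indices β ∈ ℕⁿ with 1 ≤ |β| ≤ d, and let z₁,…,z_S : ℝⁿ → ℝ be an enumeration of the monomials x^β with 1 ≤ |β| ≤ d such that z₁,…,z_n are the coordinate functions x₁,…,x_n and the degrees of z_{n+1},…,z_S are nondecreasing. Define Z : ℝⁿ → ℝ^S by Z(x) = (z₁(x),…,z_S(x)). Then there exists a matrix-valued function L : ℝⁿ → ℝ^{(S−n)×S} such that: (i) every entry of L is an affine function of x (a polynomial of degree at most 1); (ii) L(x)·Z(x) = 0 for every x ∈ ℝⁿ; (iii) the square submatrix L₂(x) consisting of the last S−n columns of L(x) is lower triangular with every diagonal entry equal to −1, so L₂(x) is invertible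 for every x ∈ ℝⁿ; and (iv) for any points v₁,…,v_N ∈ ℝⁿ and any nonnegative weights α₁,…,α_N with Σ_{i=1}^N α_i = 1 and Σ_{i=1}^N α_i v_i = x, one has L(x) = Σ_{i=1}^N α_i·L(v_i). -/
open Matrix

/-- Index of the `j`-th of the last `S - n` coordinates inside `Fin S`. -/
def lastIdx7 {S n : ℕ} (j : Fin (S - n)) : Fin S :=
  ⟨n + (j : ℕ), by have := j.2; omega⟩

/-- A multi-index of degree one is a coordinate multi-index. -/
theorem exists_eq_single_of_sum_eq_one {ι : Type*} [Fintype ι] [DecidableEq ι] {β : ι → ℕ}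
    (h : ∑ i, β i = 1) : ∃ k, β = Pi.single k 1 := by
  obtain ⟨k, -, hk⟩ := Finset.exists_ne_zero_of_sum_ne_zero (h.trans_ne one_ne_zero)
  have hsplit := Finset.add_sum_erase Finset.univ β (Finset.mem_univ k)
  refine ⟨k, funext fun j => ?_⟩
  rcases eq_or_ne j k with rfl | hj
  · rw [Pi.single_eq_same]
    omega
  · have hle := Finset.single_le_sum (f := β) (fun _ _ => Nat.zero_le _)
      (Finset.mem_erase.2 ⟨hj, Finset.mem_univ j⟩)
    rw [Pi.single_eq_of_ne hj]
    omega

/-- A nonzero multi-index is a coordinate multi-index plus another multi-index. -/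
theorem exists_eq_add_single_of_sum_pos {ι : Type*} [Fintype ι] [DecidableEq ι] {β : ι → ℕ}
    (h : 0 < ∑ i, β i) : ∃ (k : ι) (γ : ι → ℕ), β = γ + Pi.single k 1 := by
  obtain ⟨k, -, hk⟩ := Finset.exists_ne_zero_of_sum_ne_zero h.ne'
  refine ⟨k, β - Pi.single k 1, (tsub_add_cancel_of_le fun j => ?_).symm⟩
  rcases eq_or_ne j k with rfl | hj
  · simpa using Nat.one_le_iff_ne_zero.2 hk
  · simp [hj]

/-- In a degree-ordered enumeration of the monomials of degree between `1` and `d` that starts with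
the coordinates, every later monomial is a coordinate times an earlier monomial. -/
theorem exists_factor_lastIdx7 {n d S : ℕ} {ms : Fin S → (Fin n → ℕ)}
    (hms_inj : Function.Injective ms)
    (hms_range : ∀ β : Fin n → ℕ, (1 ≤ ∑ i, β i ∧ ∑ i, β i ≤ d) ↔ ∃ i, ms i = β)
    (hms_coord : ∀ i : Fin S, (i : ℕ) < n →
      ms i = fun j : Fin n => if (j : ℕ) = (i : ℕ) then 1 else 0)
    (hms_mono : ∀ i i' : Fin S, n ≤ (i : ℕ) → i ≤ i' → ∑ j, ms i j ≤ ∑ j, ms i' j)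
    (i : Fin (S - n)) :
    ∃ k p, ms (lastIdx7 i) = ms p + Pi.single k 1 ∧ p < lastIdx7 i := by
  obtain ⟨hpos, hle⟩ := (hms_range _).2 ⟨lastIdx7 i, rfl⟩
  have hval : ((lastIdx7 i : Fin S) : ℕ) = n + i := rfl
  have hne : ∑ j, ms (lastIdx7 i) j ≠ 1 := by
    intro h
    obtain ⟨k, hk⟩ := exists_eq_single_of_sum_eq_one h
    have hkS : (k : ℕ) < S := by omega
    have heq : ms (lastIdx7 i) = ms ⟨k, hkS⟩ := by
      rw [hk, hms_coord ⟨k, hkS⟩ k.2]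
      funext j
      simp [Pi.single_apply, Fin.ext_iff]
    have := congrArg Fin.val (hms_inj heq)
    simp only [hval] at this
    omega
  obtain ⟨k, γ, hγ⟩ := exists_eq_add_single_of_sum_pos hpos
  have hsum : ∑ j, ms (lastIdx7 i) j = ∑ j, γ j + 1 := by
    simp [hγ, Finset.sum_add_distrib]
  obtain ⟨p, rfl⟩ := (hms_range γ).1 ⟨by omega, by omega⟩
  refine ⟨k, p, hγ, lt_of_not_ge fun hp => ?_⟩
  have := hms_mono _ p (by omega) hp
  omega

/-- Existence of an affine constraint matrix `L` for the vector of all monomials of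
degree between `1` and `d` (Theorem 4 of the paper). -/
theorem stmt7 (n d S : ℕ) (hn : 1 ≤ n) (hd : 2 ≤ d)
    (hS : S = Nat.card {β : Fin n → ℕ // 1 ≤ ∑ i, β i ∧ ∑ i, β i ≤ d})
    (ms : Fin S → (Fin n → ℕ))
    (hms_inj : Function.Injective ms)
    (hms_range : ∀ β : Fin n → ℕ, (1 ≤ ∑ i, β i ∧ ∑ i, β i ≤ d) ↔ ∃ i, ms i = β)
    (hms_coord : ∀ i : Fin S, (i : ℕ) < n →
      ms i = fun j : Fin n => if (j : ℕ) = (i : ℕ) then 1 else 0)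
    (hms_mono : ∀ i i' : Fin S, n ≤ (i : ℕ) → i ≤ i' → ∑ j, ms i j ≤ ∑ j, ms i' j)
    (Z : (Fin n → ℝ) → (Fin S → ℝ))
    (hZ : ∀ x i, Z x i = ∏ j, x j ^ ms i j) :
    ∃ L : (Fin n → ℝ) → Matrix (Fin (S - n)) (Fin S) ℝ,
      -- (i) each entry of L is an affine function of x
      (∀ i j, ∃ c : ℝ, ∃ v : Fin n → ℝ, ∀ x, L x i j = c + ∑ k, v k * x k) ∧
      -- (ii) L(x) Z(x) = 0
      (∀ x, L x *ᵥ Z x = 0) ∧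
      -- (iii) L₂(x) (the last S-n columns of L(x)) is lower triangular with -1 diagonal
      (∀ (x : Fin n → ℝ) (i j : Fin (S - n)),
        (i < j → L x i (lastIdx7 j) = 0) ∧ L x i (lastIdx7 i) = -1) ∧
      -- ... and hence invertible
      (∀ x : Fin n → ℝ,
        IsUnit (Matrix.of fun i j : Fin (S - n) => L x i (lastIdx7 j))) ∧
      -- (iv) L is affine-polytopic
      (∀ (N : ℕ) (v : Fin N → (Fin n → ℝ)) (α : Fin N → ℝ) (x : Fin n → ℝ),
        (∀ i, 0 ≤ α i) → ∑ i, α i = 1 → (∑ i, α i • v i) = x →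
        L x = ∑ i, α i • L (v i)) := by
  classical
  choose k p hkp hlt using exists_factor_lastIdx7 hms_inj hms_range hms_coord hms_mono
  have hlast : ∀ i j : Fin (S - n), (lastIdx7 i : Fin S) = lastIdx7 j ↔ i = j := by
    intro i j
    simp [lastIdx7, Fin.ext_iff]
  let L : (Fin n → ℝ) → Matrix (Fin (S - n)) (Fin S) ℝ := fun x i j =>
    (if j = p i then x (k i) else 0) - if j = lastIdx7 i then 1 else 0
  have htri : ∀ (x : Fin n → ℝ) (i j : Fin (S - n)),
      (i < j → L x i (lastIdx7 j) = 0) ∧ L x i (lastIdx7 i) = -1 := by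
    intro x i j
    refine ⟨fun hij => ?_, ?_⟩
    · have hj : (lastIdx7 j : Fin S) ≠ p i := by
        have h1 := hlt i
        intro h
        rw [← h] at h1
        simp only [lastIdx7, Fin.mk_lt_mk] at h1
        omega
      simp [L, hj, hlast, hij.ne']
    · simp [L, (hlt i).ne']
  refine ⟨L, fun i j => ?_, fun x => ?_, htri, fun x => ?_, ?_⟩
  · refine ⟨-(if j = lastIdx7 i then 1 else 0), Pi.single (k i) (if j = p i then 1 else 0),
      fun x => ?_⟩
    simp [L, Pi.single_apply, sub_eq_neg_add]
  · funext i
    have hZi : Z x (lastIdx7 i) = x (k i) * Z x (p i) := by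
      rw [hZ, hZ, hkp i]
      simp only [Pi.add_apply, pow_add, Finset.prod_mul_distrib]
      simp [Pi.single_apply, pow_ite, mul_comm]
    simp [L, Matrix.mulVec, dotProduct, sub_mul, hZi]
  · rw [Matrix.isUnit_iff_isUnit_det, Matrix.det_of_isLowerTriangular]
    · simp [fun i => (htri x i i).2]
    · intro i j hij
      exact (htri x i j).1 hij
  · rintro N v α x - hα rfl
    ext i j
    simp only [Matrix.sum_apply, Matrix.smul_apply, smul_eq_mul]
    simp only [L, mul_sub, Finset.sum_sub_distrib, ← Finset.sum_mul, hα, one_mul]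
    split_ifs <;> simp
end

section
/- Let n, S, T, N be positive integers with S > n. Let α₁,…,α_N : ℝⁿ → ℝ be continuous with α_i(x) ≥ 0 and Σ_{i=1}^N α_i(x) = 1 for all x ∈ ℝⁿ. Let Z : ℝⁿ → ℝ^S be continuous with Z(0) = 0 and Z(x) = (x, Ẑ(x)) for some Ẑ : ℝⁿ → ℝ^{S−n}. Let 𝓛₁,…,𝓛_N ∈ ℝ^{(S−n)×S} and set L(x) := Σ_{i=1}^N α_i(x) 𝓛_i, partitioned as L(x) = [L₁(x) L₂(x)] with L₂(x) ∈ ℝ^{(S−n)×(S−n)}; assume that for every x ∈ ℝⁿ, L(x)·Z(x) = 0 and L₂(x) is invertible. Let X₁ ∈ ℝ^{n×T} and G₁,…,G_N ∈ ℝ^{T×S}; set G(x) := Σ_{i=1}^N α_i(x) G_i, partitioned as G(x) = [Ḡ(x) G̲(x)] with Ḡ(x) ∈ ℝ^{T×n}, and define Ā(x) := X₁·Ḡ(x) − X₁·G̲(x)·L₂(x)⁻¹·L₁(x) and F(x) := X₁·G(x)·Z(x) (so F(x) = Ā(x)·x for all x). Suppose there exist symmetric positive definite matrices P₁,…,P_N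 ∈ ℝ^{n×n} such that, with P(x) := Σ_{i=1}^N α_i(x) P_i, the matrix P(x) − Ā(x)ᵀ·P(x′)·Ā(x) is positive definite for all x, x′ ∈ ℝⁿ. Then the origin of the discrete-time system x_{t+1} = F(x_t) is globally asymptotically stable: F(0) = 0; for every ε > 0 there exists δ > 0 such that ‖x₀‖ ≤ δ implies ‖F^k(x₀)‖ ≤ ε for all k ∈ ℕ; and for every x₀ ∈ ℝⁿ, F^k(x₀) → 0 as k → ∞. -/
open Matrix Filter

/-- The Euclidean norm of a vector in `ℝⁿ`. -/
noncomputable def enorm8 {n : ℕ} (x : Fin n → ℝ) : ℝ := Real.sqrt (∑ i, x i ^ 2)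

open Topology

/-- Lyapunov stability for a discrete-time system with a strictly decreasing, quadratically
coercive Lyapunov function. -/
theorem eventually_forall_iterate_mem {E : Type*} [NormedAddCommGroup E] {f : E → E} {V : E → ℝ}
    {c : ℝ} (hc : 0 < c) (hV : ContinuousAt V 0) (hV0 : V 0 = 0)
    (hcoer : ∀ x, c * ‖x‖ ^ 2 ≤ V x) (hdecr : ∀ x, V (f x) ≤ V x)
    {U : Set E} (hU : U ∈ 𝓝 0) : ∀ᶠ x in 𝓝 0, ∀ k : ℕ, f^[k] x ∈ U := by
  obtain ⟨r, hr, hrU⟩ := Metric.mem_nhds_iff.1 hU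
  have hsmall : ∀ᶠ x in 𝓝 0, V x < c * r ^ 2 :=
    hV.eventually_lt_const (by rw [hV0]; positivity)
  filter_upwards [hsmall] with x hx k
  have hk : V (f^[k] x) ≤ V x := by
    induction k with
    | zero => rfl
    | succ k ih => rw [Function.iterate_succ_apply']; exact (hdecr _).trans ih
  apply hrU
  rw [mem_ball_zero_iff]
  have h : ‖f^[k] x‖ ^ 2 < r ^ 2 :=
    lt_of_mul_lt_mul_left (((hcoer _).trans hk).trans_lt hx) hc.le
  exact lt_of_pow_lt_pow_left₀ 2 hr.le h

/-- Global attractivity for a discrete-time system with a strictly decreasing, quadratically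
coercive Lyapunov function. -/
theorem tendsto_iterate_zero_of_lyapunov {E : Type*} [NormedAddCommGroup E] [ProperSpace E]
    {f : E → E} {V : E → ℝ} {c : ℝ} (hc : 0 < c) (hf : Continuous f) (hV : Continuous V)
    (hV0 : V 0 = 0) (hcoer : ∀ x, c * ‖x‖ ^ 2 ≤ V x) (hf0 : f 0 = 0)
    (hdecr : ∀ x, x ≠ 0 → V (f x) < V x) (x : E) :
    Tendsto (fun k => f^[k] x) atTop (𝓝 0) := by
  have hle (y : E) : V (f y) ≤ V y := by
    rcases eq_or_ne y 0 with rfl | hy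
    · rw [hf0]
    · exact (hdecr y hy).le
  have hanti : Antitone fun k => V (f^[k] x) := antitone_nat_of_succ_le fun k => by
    simpa only [Function.iterate_succ_apply'] using hle (f^[k] x)
  have hnonneg (y : E) : 0 ≤ V y := le_trans (by positivity) (hcoer y)
  have hlim := tendsto_atTop_ciInf hanti ⟨0, by rintro _ ⟨k, rfl⟩; exact hnonneg _⟩
  set l := ⨅ k, V (f^[k] x)
  have hbdd : ∀ k, f^[k] x ∈ Metric.closedBall (0 : E) (√(V x / c)) := fun k => by
    rw [mem_closedBall_zero_iff]
    apply Real.le_sqrt_of_sq_le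
    rw [le_div_iff₀' hc]
    exact (hcoer _).trans (hanti (Nat.zero_le k))
  obtain ⟨y, -, φ, hφ, hy⟩ := (isCompact_closedBall _ _).tendsto_subseq hbdd
  have hVy : V y = l :=
    tendsto_nhds_unique ((hV.tendsto y).comp hy) (hlim.comp hφ.tendsto_atTop)
  have hVfy : V (f y) = l := by
    refine tendsto_nhds_unique (((hV.comp hf).tendsto y).comp hy) ?_
    have := hlim.comp ((tendsto_add_atTop_nat 1).comp hφ.tendsto_atTop)
    simpa only [Function.comp_def, Function.iterate_succ_apply'] using this
  have hy0 : y = 0 := by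
    by_contra hne
    exact (hdecr y hne).ne (hVfy.trans hVy.symm)
  rw [← hVy, hy0, hV0] at hlim
  have hsq : Tendsto (fun k => ‖f^[k] x‖ ^ 2) atTop (𝓝 0) := by
    refine squeeze_zero (fun k => by positivity) (fun k => ?_) (by simpa using hlim.div_const c)
    rw [le_div_iff₀' hc]
    exact hcoer _
  rw [tendsto_zero_iff_norm_tendsto_zero]
  simpa using hsq.sqrt

theorem Matrix.PosDef.exists_pos_mul_sq_norm_le {ι : Type*} [Fintype ι] {M : Matrix ι ι ℝ}
    (hM : M.PosDef) : ∃ c > 0, ∀ x : ι → ℝ, c * ‖x‖ ^ 2 ≤ x ⬝ᵥ M *ᵥ x := by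
  have hcont : Continuous fun x : ι → ℝ => x ⬝ᵥ M *ᵥ x := by fun_prop
  rcases (Metric.sphere (0 : ι → ℝ) 1).eq_empty_or_nonempty with hemp | hne
  · refine ⟨1, one_pos, fun x => ?_⟩
    rcases eq_or_ne x 0 with rfl | hx
    · simp
    · have hmem : ‖x‖⁻¹ • x ∈ Metric.sphere (0 : ι → ℝ) 1 := by
        simp [norm_smul, hx]
      simp [hemp] at hmem
  · obtain ⟨u, hu, hmin⟩ := (isCompact_sphere _ _).exists_isMinOn hne hcont.continuousOn
    have hu0 : u ≠ 0 := by
      rintro rfl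
      simp at hu
    refine ⟨u ⬝ᵥ M *ᵥ u, by simpa using hM.dotProduct_mulVec_pos hu0, fun x => ?_⟩
    rcases eq_or_ne x 0 with rfl | hx
    · simp
    · have hmem : ‖x‖⁻¹ • x ∈ Metric.sphere (0 : ι → ℝ) 1 := by
        simp [norm_smul, hx]
      have h := isMinOn_iff.1 hmin _ hmem
      simp only [mulVec_smul, dotProduct_smul, smul_dotProduct, smul_eq_mul] at h
      have hx' : 0 < ‖x‖ := norm_pos_iff.2 hx
      calc u ⬝ᵥ M *ᵥ u * ‖x‖ ^ 2
          ≤ ‖x‖⁻¹ * (‖x‖⁻¹ * x ⬝ᵥ M *ᵥ x) * ‖x‖ ^ 2 := by gcongr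
        _ = x ⬝ᵥ M *ᵥ x := by field_simp

/-- A finite family of positive definite forms has convex combinations that are uniformly
coercive. -/
theorem Matrix.exists_pos_mul_sq_norm_le_sum_smul {ι κ : Type*} [Fintype ι] [Fintype κ]
    [Nonempty κ] {P : κ → Matrix ι ι ℝ} (hP : ∀ i, (P i).PosDef) :
    ∃ c > 0, ∀ w : κ → ℝ, (∀ i, 0 ≤ w i) → ∑ i, w i = 1 →
      ∀ x : ι → ℝ, c * ‖x‖ ^ 2 ≤ x ⬝ᵥ (∑ i, w i • P i) *ᵥ x := by
  choose c hc hcP using fun i => (hP i).exists_pos_mul_sq_norm_le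
  obtain ⟨j, -, hj⟩ := Finset.exists_min_image Finset.univ c Finset.univ_nonempty
  refine ⟨c j, hc j, fun w hw hsum x => ?_⟩
  calc c j * ‖x‖ ^ 2 = ∑ i, w i * (c j * ‖x‖ ^ 2) := by rw [← Finset.sum_mul, hsum, one_mul]
    _ ≤ ∑ i, w i * (x ⬝ᵥ P i *ᵥ x) := by
      refine Finset.sum_le_sum fun i _ => mul_le_mul_of_nonneg_left ?_ (hw i)
      exact (mul_le_mul_of_nonneg_right (hj i (Finset.mem_univ i)) (by positivity)).trans
        (hcP i x)
    _ = x ⬝ᵥ (∑ i, w i • P i) *ᵥ x := by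
      simp [sum_mulVec, dotProduct_sum, smul_mulVec]

theorem Matrix.mulVec_eq_submatrix_inl_add_inr {m ι κ R : Type*} [Fintype ι] [Fintype κ]
    [NonUnitalNonAssocSemiring R] (M : Matrix m (ι ⊕ κ) R) (v : ι ⊕ κ → R) :
    M *ᵥ v = M.submatrix id Sum.inl *ᵥ (v ∘ Sum.inl) +
      M.submatrix id Sum.inr *ᵥ (v ∘ Sum.inr) := by
  ext i
  simp [mulVec, dotProduct, Fintype.sum_sum_type]

/-- Eliminating the algebraic variables of a descriptor constraint `L v = 0` whose algebraic
block is invertible. -/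
theorem Matrix.mulVec_eq_schur_mulVec {m ι κ R : Type*} [Fintype ι] [Fintype κ]
    [DecidableEq κ] [CommRing R] (M : Matrix m (ι ⊕ κ) R) (L : Matrix κ (ι ⊕ κ) R)
    (hL : IsUnit (L.submatrix id Sum.inr)) {v : ι ⊕ κ → R} (hv : L *ᵥ v = 0) :
    M *ᵥ v = (M.submatrix id Sum.inl -
      M.submatrix id Sum.inr * (L.submatrix id Sum.inr)⁻¹ * L.submatrix id Sum.inl) *ᵥ
        (v ∘ Sum.inl) := by
  have hinr : v ∘ Sum.inr =
      -((L.submatrix id Sum.inr)⁻¹ *ᵥ (L.submatrix id Sum.inl *ᵥ (v ∘ Sum.inl))) := by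
    rw [mulVec_eq_submatrix_inl_add_inr] at hv
    rw [eq_neg_of_add_eq_zero_left hv, mulVec_neg, neg_neg, mulVec_mulVec,
      nonsing_inv_mul _ ((isUnit_iff_isUnit_det _).1 hL), one_mulVec]
  rw [mulVec_eq_submatrix_inl_add_inr, hinr, sub_mulVec, mulVec_neg, ← sub_eq_add_neg]
  simp only [mulVec_mulVec, Matrix.mul_assoc]

theorem continuous_enorm8 {n : ℕ} : Continuous (enorm8 : (Fin n → ℝ) → ℝ) := by
  unfold enorm8
  fun_prop

theorem norm_le_enorm8 {n : ℕ} (x : Fin n → ℝ) : ‖x‖ ≤ enorm8 x := by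
  refine (pi_norm_le_iff_of_nonneg (Real.sqrt_nonneg _)).2 fun i => ?_
  refine Real.le_sqrt_of_sq_le ?_
  rw [Real.norm_eq_abs, sq_abs]
  exact Finset.single_le_sum (f := fun i => x i ^ 2) (fun j _ => sq_nonneg _)
    (Finset.mem_univ i)

/-- Descriptor embedding, global case (Theorem 3 of the paper): poly-quadratic
admissibility of the embedded descriptor system — expressed via invertibility of `L₂(x)`
and the parameter-dependent Lyapunov decrease condition on `Ā(x)` — implies global
asymptotic stability of the origin of `x_{t+1} = X₁ G(x_t) Z(x_t)`.
The index type `Fin n ⊕ Fin s` plays the role of `ℝ^S` with `S = n + s > n`. -/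
theorem stmt8 (n s T N : ℕ) (hn : 0 < n) (hs : 0 < s) (hT : 0 < T) (hN : 0 < N)
    (α : Fin N → (Fin n → ℝ) → ℝ)
    (hαc : ∀ i, Continuous (α i))
    (hα0 : ∀ i x, 0 ≤ α i x) (hα1 : ∀ x, ∑ i, α i x = 1)
    (Z : (Fin n → ℝ) → (Fin n ⊕ Fin s → ℝ))
    (hZc : Continuous Z) (hZ0 : Z 0 = 0)
    (hZx : ∀ x i, Z x (Sum.inl i) = x i)
    (𝓛 : Fin N → Matrix (Fin s) (Fin n ⊕ Fin s) ℝ)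
    (L : (Fin n → ℝ) → Matrix (Fin s) (Fin n ⊕ Fin s) ℝ)
    (hL : ∀ x, L x = ∑ i, α i x • 𝓛 i)
    (hLZ : ∀ x, L x *ᵥ Z x = 0)
    (hL₂ : ∀ x, IsUnit ((L x).submatrix id Sum.inr))
    (X₁ : Matrix (Fin n) (Fin T) ℝ)
    (G : Fin N → Matrix (Fin T) (Fin n ⊕ Fin s) ℝ)
    (Gx : (Fin n → ℝ) → Matrix (Fin T) (Fin n ⊕ Fin s) ℝ)
    (hG : ∀ x, Gx x = ∑ i, α i x • G i)
    (Abar : (Fin n → ℝ) → Matrix (Fin n) (Fin n) ℝ)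
    (hAbar : ∀ x, Abar x =
      X₁ * (Gx x).submatrix id Sum.inl -
        X₁ * (Gx x).submatrix id Sum.inr * ((L x).submatrix id Sum.inr)⁻¹ *
          (L x).submatrix id Sum.inl)
    (F : (Fin n → ℝ) → (Fin n → ℝ))
    (hF : ∀ x, F x = (X₁ * Gx x) *ᵥ Z x)
    (P : Fin N → Matrix (Fin n) (Fin n) ℝ) (hP : ∀ i, (P i).PosDef)
    (hLyap : ∀ x x' : Fin n → ℝ,
      ((∑ i, α i x • P i) - (Abar x)ᵀ * (∑ i, α i x' • P i) * Abar x).PosDef) :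
    F 0 = 0 ∧
    (∀ ε > 0, ∃ δ > 0, ∀ x₀ : Fin n → ℝ, enorm8 x₀ ≤ δ →
      ∀ k : ℕ, enorm8 (F^[k] x₀) ≤ ε) ∧
    (∀ x₀ : Fin n → ℝ, Tendsto (fun k => F^[k] x₀) atTop (nhds 0)) := by
  have hFA (x : Fin n → ℝ) : F x = Abar x *ᵥ x := by
    have hinl : Z x ∘ Sum.inl = x := funext (hZx x)
    rw [hF, mulVec_eq_schur_mulVec _ _ (hL₂ x) (hLZ x), hinl, hAbar]
    rfl
  have hF0 : F 0 = 0 := by rw [hF, hZ0, mulVec_zero]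
  have hFc : Continuous F := by
    simp only [funext hF, hG]
    fun_prop
  have : Nonempty (Fin N) := ⟨⟨0, hN⟩⟩
  obtain ⟨c, hc, hcP⟩ := exists_pos_mul_sq_norm_le_sum_smul hP
  let V : (Fin n → ℝ) → ℝ := fun x => x ⬝ᵥ (∑ i, α i x • P i) *ᵥ x
  have hVc : Continuous V := by
    unfold V
    fun_prop
  have hV0 : V 0 = 0 := zero_dotProduct _
  have hcoer (x : Fin n → ℝ) : c * ‖x‖ ^ 2 ≤ V x :=
    hcP _ (fun i => hα0 i x) (hα1 x) x
  have hdecr (x : Fin n → ℝ) (hx : x ≠ 0) : V (F x) < V x := by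
    have h := (hLyap x (F x)).dotProduct_mulVec_pos hx
    rw [star_trivial, sub_mulVec, dotProduct_sub, sub_pos] at h
    rwa [← mulVec_mulVec, ← mulVec_mulVec, dotProduct_mulVec x (Abar x)ᵀ, vecMul_transpose,
      ← hFA] at h
  refine ⟨hF0, fun ε hε => ?_, tendsto_iterate_zero_of_lyapunov hc hFc hVc hV0 hcoer hF0 hdecr⟩
  have hle (x : Fin n → ℝ) : V (F x) ≤ V x := by
    rcases eq_or_ne x 0 with rfl | hx
    · rw [hF0]
    · exact (hdecr x hx).le
  have hU : {x : Fin n → ℝ | enorm8 x ≤ ε} ∈ 𝓝 0 := by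
    have h0 : enorm8 (0 : Fin n → ℝ) < ε := by simpa [enorm8] using hε
    exact (continuous_enorm8.continuousAt.eventually_lt_const h0).mono fun _ => le_of_lt
  obtain ⟨r, hr, hball⟩ := Metric.nhds_basis_closedBall.eventually_iff.1
    (eventually_forall_iterate_mem hc hVc.continuousAt hV0 hcoer hle hU)
  exact ⟨r, hr, fun x hx => hball (mem_closedBall_zero_iff.2 ((norm_le_enorm8 x).trans hx))⟩
end

section
/- Let n, m, S, T, N be positive integers with S > n, and fix δ ∈ ℝ. Let α₁,…,α_N : ℝⁿ → ℝ be continuous with α_i(x) ≥ 0 and Σ_{i=1}^N α_i(x) = 1 for all x ∈ ℝⁿ. Let Z : ℝⁿ → ℝ^S be continuous with Z(0) = 0 and Z(x) = (x, Ẑ(x)) for some Ẑ : ℝⁿ → ℝ^{S−n}. Let 𝓛₁,…,𝓛_N ∈ ℝ^{(S−n)×S}; set L(x) := Σ_{i=1}^N α_i(x) 𝓛_i = [L₁(x) L₂(x)] with L₂(x) ∈ ℝ^{(S−n)×(S−n)}, and assume L(x)·Z(x) = 0 and L₂(x) invertible for every x ∈ ℝⁿ. Let A ∈ ℝ^{n×S},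 B ∈ ℝ^{n×m}, and let U₀ ∈ ℝ^{m×T}, Z₀ ∈ ℝ^{S×T}, X₁ ∈ ℝ^{n×T} satisfy X₁ = A·Z₀ + B·U₀. Suppose there exist matrices R_i ∈ ℝ^{T×S} and symmetric positive definite Q_i ∈ ℝ^{n×n} for i = 1,…,N, together with M ∈ ℝ^{n×n}, C₁ ∈ ℝ^{(S−n)×n} and an invertible C₂ ∈ ℝ^{(S−n)×(S−n)}, such that: (a) for every pair (i,j) ∈ {1,…,N}², the symmetric (S+n)×(S+n) block matrix with top-left S×S block sym([X₁; 𝓛_i·Z₀]·R_i·blkdiag(δI_n, I_{S−n})) + blkdiag(Q_j, 0_{(S−n)×(S−n)}), top-right S×n block [X₁; 𝓛_i·Z₀]·R_i·[I_n; 0] + [δMᵀ; 0], and bottom-right n×n block M + Mᵀ − Q_i, is positive definite; and (b) Z₀·R_i = [[M, 0],[C₁, C₂]] for every i. Define K_i := U₀·R_i·[[M, 0],[C₁, C₂]]⁻¹, K(x) := Σ_{i=1}^N α_i(x) K_i, F(x) := (A + B·K(x))·Z(x), and V(x) := xᵀ·(Σ_{i=1}^N α_i(x) Q_i⁻¹)·x.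 Then V(F(x)) < V(x) for every x ≠ 0, and the origin of x_{t+1} = F(x_t) is globally asymptotically stable: F(0) = 0; for every ε > 0 there exists δ′ > 0 such that ‖x₀‖ ≤ δ′ implies ‖F^k(x₀)‖ ≤ ε for all k ∈ ℕ; and F^k(x₀) → 0 as k → ∞ for every x₀ ∈ ℝⁿ. -/
open Matrix Filter

/-- The Euclidean norm of a vector in `ℝⁿ`. -/
noncomputable def enorm10 {n : ℕ} (x : Fin n → ℝ) : ℝ := Real.sqrt (∑ i, x i ^ 2)

open scoped Topology in
theorem lyapunov_stable {E : Type*} [NormedAddCommGroup E] {F : E → E} {V : E → ℝ}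
    {c : ℝ} (hc : 0 < c) (hF0 : F 0 = 0) (hVc : Continuous V) (hV0 : V 0 = 0)
    (hV : ∀ x, c * ‖x‖ ^ 2 ≤ V x) (hdec : ∀ x, x ≠ 0 → V (F x) < V x) :
    ∀ ε > 0, ∀ᶠ x in 𝓝 0, ∀ k, ‖F^[k] x‖ ≤ ε := by
  have hle (x) : V (F x) ≤ V x := by
    rcases eq_or_ne x 0 with rfl | hx
    · rw [hF0]
    · exact (hdec x hx).le
  intro ε hε
  have hev : ∀ᶠ x in 𝓝 (0 : E), V x < c * ε ^ 2 :=
    hVc.continuousAt.eventually_lt continuousAt_const (by rw [hV0]; positivity)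
  filter_upwards [hev] with x hx k
  have hk : V (F^[k] x) ≤ V x := by
    induction k with
    | zero => rfl
    | succ k ih => rw [Function.iterate_succ_apply']; exact (hle _).trans ih
  have h : c * ‖F^[k] x‖ ^ 2 ≤ c * ε ^ 2 := (hV _).trans (hk.trans hx.le)
  exact le_of_sq_le_sq (le_of_mul_le_mul_left h hc) hε.le

open scoped Topology in
theorem lyapunov_attractive {E : Type*} [NormedAddCommGroup E] [ProperSpace E] {F : E → E}
    {V : E → ℝ} {c : ℝ} (hc : 0 < c) (hFc : Continuous F) (hF0 : F 0 = 0) (hVc : Continuous V)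
    (hV0 : V 0 = 0) (hV : ∀ x, c * ‖x‖ ^ 2 ≤ V x) (hdec : ∀ x, x ≠ 0 → V (F x) < V x) (x : E) :
    Tendsto (fun k => F^[k] x) atTop (𝓝 0) := by
  have hle (x) : V (F x) ≤ V x := by
    rcases eq_or_ne x 0 with rfl | hx
    · rw [hF0]
    · exact (hdec x hx).le
  have hVnn (x) : 0 ≤ V x := le_trans (by positivity) (hV x)
  have hanti : Antitone fun k => V (F^[k] x) :=
    antitone_nat_of_succ_le fun k => by rw [Function.iterate_succ_apply']; exact hle _
  have hlim := tendsto_atTop_ciInf hanti ⟨0, by rintro _ ⟨k, rfl⟩; exact hVnn _⟩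
  set l := ⨅ k, V (F^[k] x)
  have hbdd : ∀ k, F^[k] x ∈ Metric.closedBall (0 : E) (√(V x / c)) := fun k => by
    rw [mem_closedBall_zero_iff]
    apply Real.le_sqrt_of_sq_le
    rw [le_div_iff₀' hc]
    exact (hV _).trans (hanti (Nat.zero_le k))
  obtain ⟨y, -, φ, hφ, hy⟩ := (isCompact_closedBall (0 : E) _).tendsto_subseq hbdd
  have hVy : V y = l := tendsto_nhds_unique ((hVc.tendsto y).comp hy) (hlim.comp hφ.tendsto_atTop)
  have hVFy : V (F y) = l := by
    refine tendsto_nhds_unique (((hVc.comp hFc).tendsto y).comp hy)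
      (((hlim.comp (tendsto_add_atTop_nat 1)).comp hφ.tendsto_atTop).congr fun k => ?_)
    simp [Function.iterate_succ_apply']
  have hy0 : y = 0 := by
    by_contra h
    exact (hdec y h).ne (hVFy.trans hVy.symm)
  have hl : l = 0 := by rw [← hVy, hy0, hV0]
  rw [hl] at hlim
  have hsq : Tendsto (fun k => ‖F^[k] x‖ ^ 2) atTop (𝓝 0) := by
    refine squeeze_zero (fun _ => sq_nonneg _) (fun k => ?_) (by simpa using hlim.div_const c)
    rw [le_div_iff₀' hc]
    exact hV _
  rw [tendsto_zero_iff_norm_tendsto_zero]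
  simpa [Function.comp_def, Real.sqrt_sq (norm_nonneg _)] using (Real.continuous_sqrt.tendsto 0).comp hsq


theorem Matrix.PosDef.exists_pos_mul_norm_sq_le {ι : Type*} [Fintype ι] {P : Matrix ι ι ℝ}
    (hP : P.PosDef) : ∃ c > 0, ∀ x : ι → ℝ, c * ‖x‖ ^ 2 ≤ x ⬝ᵥ (P *ᵥ x) := by
  obtain ⟨c, hc, h⟩ := (isCompact_sphere (0 : ι → ℝ) 1).exists_forall_le'
    (f := fun x => x ⬝ᵥ (P *ᵥ x)) (by fun_prop) (a := 0) fun x hx => by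
      simpa using hP.dotProduct_mulVec_pos (x := x) (ne_zero_of_mem_unit_sphere ⟨x, hx⟩)
  refine ⟨c, hc, fun x => ?_⟩
  rcases eq_or_ne x 0 with rfl | hx
  · simp
  have hx' : ‖x‖ ≠ 0 := norm_ne_zero_iff.2 hx
  have := h (‖x‖⁻¹ • x) (by simp [norm_smul, hx'])
  simp only [mulVec_smul, smul_dotProduct, dotProduct_smul, smul_eq_mul] at this
  calc c * ‖x‖ ^ 2 ≤ ‖x‖⁻¹ * (‖x‖⁻¹ * (x ⬝ᵥ (P *ᵥ x))) * ‖x‖ ^ 2 := by gcongr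
    _ = x ⬝ᵥ (P *ᵥ x) := by field_simp

/-- Young's inequality for the quadratic form of a positive definite matrix. -/
theorem Matrix.PosDef.two_mul_dotProduct_sub_le {ι : Type*} [Fintype ι] [DecidableEq ι]
    {Q : Matrix ι ι ℝ} (hQ : Q.PosDef) (w x : ι → ℝ) :
    2 * (w ⬝ᵥ x) - w ⬝ᵥ (Q *ᵥ w) ≤ x ⬝ᵥ (Q⁻¹ *ᵥ x) := by
  have h := hQ.posSemidef.dotProduct_mulVec_nonneg (w - Q⁻¹ *ᵥ x)
  have hQQ : Q *ᵥ (Q⁻¹ *ᵥ x) = x := by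
    rw [mulVec_mulVec, mul_nonsing_inv _ ((isUnit_iff_isUnit_det _).1 hQ.isUnit), one_mulVec]
  have hT : Qᵀ = Q := conjTranspose_eq_transpose_of_trivial Q ▸ hQ.isHermitian.eq
  have hcross : (Q⁻¹ *ᵥ x) ⬝ᵥ (Q *ᵥ w) = w ⬝ᵥ x := by
    rw [dotProduct_mulVec, ← mulVec_transpose, hT, hQQ, dotProduct_comm]
  simp only [star_trivial, mulVec_sub, hQQ, sub_dotProduct, dotProduct_sub, hcross] at h
  rw [dotProduct_comm (Q⁻¹ *ᵥ x) x] at h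
  linarith

/-- A test vector `(v₁, v₂, w)` in the block linear matrix inequality, where `a` and `b` are the
blocks of the image of `(δ v₁ + w, v₂)` under `H`. -/
theorem pos_of_posDef_fromBlocks {p q : Type*} [Fintype p] [Fintype q] [DecidableEq p]
    [DecidableEq q] {δ : ℝ} {H : Matrix (p ⊕ q) (p ⊕ q) ℝ} {M Q₁ Q₂ : Matrix p p ℝ}
    (h : (fromBlocks
        (H * fromBlocks (δ • (1 : Matrix p p ℝ)) 0 0 (1 : Matrix q q ℝ) +
          (H * fromBlocks (δ • (1 : Matrix p p ℝ)) 0 0 (1 : Matrix q q ℝ))ᵀ +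
          fromBlocks Q₂ 0 0 0)
        (H * fromRows (1 : Matrix p p ℝ) (0 : Matrix q p ℝ) +
          fromRows (δ • Mᵀ) (0 : Matrix q p ℝ))
        (H * fromRows (1 : Matrix p p ℝ) (0 : Matrix q p ℝ) +
          fromRows (δ • Mᵀ) (0 : Matrix q p ℝ))ᵀ
        (M + Mᵀ - Q₁)).PosDef)
    {v₁ w a : p → ℝ} {v₂ b : q → ℝ} (hH : H *ᵥ Sum.elim (δ • v₁ + w) v₂ = Sum.elim a b)
    (hne : δ • v₁ + w ≠ 0) :
    0 < 2 * (v₁ ⬝ᵥ a) + 2 * (v₂ ⬝ᵥ b) + v₁ ⬝ᵥ (Q₂ *ᵥ v₁) +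
      2 * (w ⬝ᵥ (M *ᵥ (δ • v₁ + w))) - w ⬝ᵥ (Q₁ *ᵥ w) := by
  have hne' : Sum.elim (Sum.elim v₁ v₂) w ≠ 0 := by
    intro h0
    apply hne
    have h1 : v₁ = 0 := funext fun i => congrFun h0 (Sum.inl (Sum.inl i))
    have h2 : w = 0 := funext fun i => congrFun h0 (Sum.inr i)
    simp [h1, h2]
  have hpos := h.dotProduct_mulVec_pos hne'
  have hsplit : H *ᵥ Sum.elim (δ • v₁) v₂ + H *ᵥ Sum.elim w 0 = Sum.elim a b := by
    rw [← mulVec_add, ← hH, ← Sum.elim_add_add, add_zero]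
  have hab : Sum.elim v₁ v₂ ⬝ᵥ (H *ᵥ Sum.elim (δ • v₁) v₂) +
      Sum.elim v₁ v₂ ⬝ᵥ (H *ᵥ Sum.elim w 0) = v₁ ⬝ᵥ a + v₂ ⬝ᵥ b := by
    rw [← dotProduct_add, hsplit, sumElim_dotProduct_sumElim]
  simp only [star_trivial, fromBlocks_mulVec, Sum.elim_comp_inl, Sum.elim_comp_inr,
    sumElim_dotProduct_sumElim, add_mulVec, sub_mulVec, dotProduct_add, dotProduct_sub, dotProduct_transpose_mulVec,
    ← mulVec_mulVec, fromRows_mulVec, smul_mulVec, one_mulVec, zero_mulVec, add_zero,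
    zero_add, dotProduct_zero, dotProduct_smul, smul_eq_mul] at hpos
  simp only [mulVec_add, mulVec_smul, dotProduct_add, dotProduct_smul, smul_eq_mul]
  linarith

theorem sum_mul_pos_of_sum_eq_one {ι : Type*} [Fintype ι] {a t : ι → ℝ} (ha : ∀ i, 0 ≤ a i)
    (ha1 : ∑ i, a i = 1) (ht : ∀ i, 0 < t i) : 0 < ∑ i, a i * t i := by
  obtain ⟨i, hi, hai⟩ := Finset.exists_ne_zero_of_sum_ne_zero (ha1.trans_ne one_ne_zero)
  exact Finset.sum_pos' (fun k _ => mul_nonneg (ha k) (ht k).le)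
    ⟨i, hi, mul_pos ((ha i).lt_of_ne' hai) (ht i)⟩

theorem norm_le_enorm10 {n : ℕ} (x : Fin n → ℝ) : ‖x‖ ≤ enorm10 x := by
  refine (pi_norm_le_iff_of_nonneg (Real.sqrt_nonneg _)).2 fun i => Real.abs_le_sqrt ?_
  exact Finset.single_le_sum (f := fun i => x i ^ 2) (fun i _ => sq_nonneg _) (Finset.mem_univ i)

theorem enorm10_le {n : ℕ} (x : Fin n → ℝ) : enorm10 x ≤ √n * ‖x‖ := by
  apply Real.sqrt_le_iff.2 ⟨by positivity, ?_⟩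
  rw [mul_pow, Real.sq_sqrt (Nat.cast_nonneg n)]
  calc ∑ i, x i ^ 2 ≤ ∑ _i : Fin n, ‖x‖ ^ 2 :=
        Finset.sum_le_sum fun i _ => sq_le_sq.2 (by simpa using norm_le_pi_norm x i)
    _ = n * ‖x‖ ^ 2 := by simp

theorem isUnit_of_posDef_add_transpose_sub {p : Type*} [Fintype p] [DecidableEq p]
    {M Q : Matrix p p ℝ} (hQ : Q.PosDef) (h : (M + Mᵀ - Q).PosDef) : IsUnit M := by
  rw [← mulVec_injective_iff_isUnit]
  refine (injective_iff_map_eq_zero M.mulVecLin).2 ?_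
  intro v hv
  by_contra hv0
  have h1 := h.dotProduct_mulVec_pos hv0
  have h2 := hQ.dotProduct_mulVec_pos hv0
  have h3 : M *ᵥ v = 0 := hv
  have h4 : v ⬝ᵥ (Mᵀ *ᵥ v) = 0 := by
    rw [mulVec_transpose, dotProduct_comm, ← dotProduct_mulVec, h3, dotProduct_zero]
  simp only [star_trivial, sub_mulVec, add_mulVec, dotProduct_sub, dotProduct_add, h3, h4,
    dotProduct_zero] at h1 h2
  linarith

/-- Main data-driven stabilization result (Theorem 5 of the paper, global case):
feasibility of the data-dependent LMIs yields a polytopic state-feedback controller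
`u = K(x) Z(x)` rendering the origin of `x_{t+1} = (A + B K(x_t)) Z(x_t)` globally
asymptotically stable, with parameter-dependent Lyapunov function
`V(x) = xᵀ (Σ_i α_i(x) Q_i⁻¹) x`.
The index type `Fin n ⊕ Fin s` plays the role of `ℝ^S` with `S = n + s > n`. -/
theorem stmt10 (n m s T N : ℕ) (hn : 0 < n) (hm : 0 < m) (hs : 0 < s) (hT : 0 < T)
    (hN : 0 < N) (δ : ℝ)
    (α : Fin N → (Fin n → ℝ) → ℝ)
    (hαc : ∀ i, Continuous (α i))
    (hα0 : ∀ i x, 0 ≤ α i x) (hα1 : ∀ x, ∑ i, α i x = 1)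
    (Z : (Fin n → ℝ) → (Fin n ⊕ Fin s → ℝ))
    (hZc : Continuous Z) (hZ0 : Z 0 = 0)
    (hZx : ∀ x i, Z x (Sum.inl i) = x i)
    (𝓛 : Fin N → Matrix (Fin s) (Fin n ⊕ Fin s) ℝ)
    (L : (Fin n → ℝ) → Matrix (Fin s) (Fin n ⊕ Fin s) ℝ)
    (hL : ∀ x, L x = ∑ i, α i x • 𝓛 i)
    (hLZ : ∀ x, L x *ᵥ Z x = 0)
    (hL₂ : ∀ x, IsUnit ((L x).submatrix id Sum.inr))
    (A : Matrix (Fin n) (Fin n ⊕ Fin s) ℝ) (B : Matrix (Fin n) (Fin m) ℝ)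
    (U₀ : Matrix (Fin m) (Fin T) ℝ) (Z₀ : Matrix (Fin n ⊕ Fin s) (Fin T) ℝ)
    (X₁ : Matrix (Fin n) (Fin T) ℝ)
    (hdata : X₁ = A * Z₀ + B * U₀)
    (R : Fin N → Matrix (Fin T) (Fin n ⊕ Fin s) ℝ)
    (Q : Fin N → Matrix (Fin n) (Fin n) ℝ) (hQ : ∀ i, (Q i).PosDef)
    (M : Matrix (Fin n) (Fin n) ℝ)
    (C₁ : Matrix (Fin s) (Fin n) ℝ) (C₂ : Matrix (Fin s) (Fin s) ℝ)
    (hC₂ : IsUnit C₂)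
    -- (a) the data-dependent LMIs
    (hLMI : ∀ i j : Fin N,
      (Matrix.fromBlocks
        ((Matrix.fromRows X₁ (𝓛 i * Z₀) * R i *
            Matrix.fromBlocks (δ • (1 : Matrix (Fin n) (Fin n) ℝ)) 0 0
              (1 : Matrix (Fin s) (Fin s) ℝ)) +
          (Matrix.fromRows X₁ (𝓛 i * Z₀) * R i *
            Matrix.fromBlocks (δ • (1 : Matrix (Fin n) (Fin n) ℝ)) 0 0
              (1 : Matrix (Fin s) (Fin s) ℝ))ᵀ +
          Matrix.fromBlocks (Q j) 0 0 0)
        (Matrix.fromRows X₁ (𝓛 i * Z₀) * R i *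
            Matrix.fromRows (1 : Matrix (Fin n) (Fin n) ℝ) (0 : Matrix (Fin s) (Fin n) ℝ) +
          Matrix.fromRows (δ • Mᵀ) (0 : Matrix (Fin s) (Fin n) ℝ))
        (Matrix.fromRows X₁ (𝓛 i * Z₀) * R i *
            Matrix.fromRows (1 : Matrix (Fin n) (Fin n) ℝ) (0 : Matrix (Fin s) (Fin n) ℝ) +
          Matrix.fromRows (δ • Mᵀ) (0 : Matrix (Fin s) (Fin n) ℝ))ᵀ
        (M + Mᵀ - Q i)).PosDef)
    -- (b) the equality constraint
    (hZR : ∀ i, Z₀ * R i = Matrix.fromBlocks M 0 C₁ C₂)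
    -- the controller and the closed loop
    (K : Fin N → Matrix (Fin m) (Fin n ⊕ Fin s) ℝ)
    (hK : ∀ i, K i = U₀ * R i * (Matrix.fromBlocks M 0 C₁ C₂)⁻¹)
    (F : (Fin n → ℝ) → (Fin n → ℝ))
    (hF : ∀ x, F x = (A + B * ∑ i, α i x • K i) *ᵥ Z x)
    (V : (Fin n → ℝ) → ℝ)
    (hV : ∀ x, V x = x ⬝ᵥ ((∑ i, α i x • (Q i)⁻¹) *ᵥ x)) :
    (∀ x : Fin n → ℝ, x ≠ 0 → V (F x) < V x) ∧
    F 0 = 0 ∧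
    (∀ ε > 0, ∃ δ' > 0, ∀ x₀ : Fin n → ℝ, enorm10 x₀ ≤ δ' →
      ∀ k : ℕ, enorm10 (F^[k] x₀) ≤ ε) ∧
    (∀ x₀ : Fin n → ℝ, Tendsto (fun k => F^[k] x₀) atTop (nhds 0)) := by
  have hMu : IsUnit M :=
    isUnit_of_posDef_add_transpose_sub (hQ ⟨0, hN⟩)
      ((hLMI ⟨0, hN⟩ ⟨0, hN⟩).submatrix Sum.inr_injective)
  have hW : IsUnit (fromBlocks M 0 C₁ C₂).det := by
    rw [det_fromBlocks_zero₁₂]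
    exact ((isUnit_iff_isUnit_det M).1 hMu).mul ((isUnit_iff_isUnit_det C₂).1 hC₂)
  set W := fromBlocks M 0 C₁ C₂ with hWdef
  have hFsum (x) : F x = ∑ i, α i x • ((A + B * K i) *ᵥ Z x) := by
    rw [hF, Matrix.mul_sum, add_mulVec, sum_mulVec]
    simp only [add_mulVec, smul_add, Finset.sum_add_distrib, ← Finset.sum_smul, hα1, one_smul,
      Matrix.mul_smul, smul_mulVec]
  have hLsum (x) : ∑ i, α i x • (𝓛 i *ᵥ Z x) = 0 := by
    rw [← hLZ x, hL, sum_mulVec]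
    simp only [smul_mulVec]
  have hVsum (x y) : y ⬝ᵥ ((∑ i, α i x • (Q i)⁻¹) *ᵥ y) = ∑ i, α i x * (y ⬝ᵥ ((Q i)⁻¹ *ᵥ y)) := by
    simp only [sum_mulVec, dotProduct_sum, smul_mulVec, dotProduct_smul, smul_eq_mul]
  have hstep (j) (x) (hx : x ≠ 0) : F x ⬝ᵥ ((Q j)⁻¹ *ᵥ F x) < V x := by
    set y := W⁻¹ *ᵥ Z x with hy
    have hWy : W *ᵥ y = Z x := by rw [hy, mulVec_mulVec, mul_nonsing_inv _ hW, one_mulVec]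
    obtain ⟨u, v₂, huv⟩ : ∃ u v₂, y = Sum.elim u v₂ := ⟨_, _, (Sum.elim_comp_inl_inr y).symm⟩
    have hMx : M *ᵥ u = x := by
      funext k
      rw [← hZx x k, ← hWy, huv, hWdef, fromBlocks_mulVec]
      simp
    have hu : u ≠ 0 := by
      rintro rfl
      exact hx (by rw [← hMx, mulVec_zero])
    set v₁ := -((Q j)⁻¹ *ᵥ F x) with hv₁
    have hvw : δ • v₁ + (u - δ • v₁) = u := by abel
    have hH (i) : (fromRows X₁ (𝓛 i * Z₀) * R i) *ᵥ Sum.elim (δ • v₁ + (u - δ • v₁)) v₂ =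
        Sum.elim ((A + B * K i) *ᵥ Z x) (𝓛 i *ᵥ Z x) := by
      have hX : X₁ * R i = (A + B * K i) * W := by
        rw [hdata, hK, Matrix.add_mul, Matrix.add_mul, Matrix.mul_assoc, hZR, Matrix.mul_assoc B,
          Matrix.mul_assoc B, nonsing_inv_mul_cancel_right _ _ hW]
      rw [hvw, ← huv, fromRows_mul, fromRows_mulVec, hX, Matrix.mul_assoc, hZR, ← mulVec_mulVec,
        ← mulVec_mulVec, hWy]
    have hpos (i) : 0 < 2 * (v₁ ⬝ᵥ ((A + B * K i) *ᵥ Z x)) + 2 * (v₂ ⬝ᵥ (𝓛 i *ᵥ Z x)) +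
        v₁ ⬝ᵥ (Q j *ᵥ v₁) + x ⬝ᵥ ((Q i)⁻¹ *ᵥ x) := by
      have h := pos_of_posDef_fromBlocks (hLMI i j) (hH i) (by rwa [hvw])
      rw [hvw, hMx] at h
      linarith [(hQ i).two_mul_dotProduct_sub_le (u - δ • v₁) x]
    have hsum := sum_mul_pos_of_sum_eq_one (fun i => hα0 i x) (hα1 x) hpos
    have hlin : ∑ i, α i x * (2 * (v₁ ⬝ᵥ ((A + B * K i) *ᵥ Z x)) + 2 * (v₂ ⬝ᵥ (𝓛 i *ᵥ Z x)) +
        v₁ ⬝ᵥ (Q j *ᵥ v₁) + x ⬝ᵥ ((Q i)⁻¹ *ᵥ x)) =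
        2 * (v₁ ⬝ᵥ F x) + 2 * (v₂ ⬝ᵥ (0 : Fin s → ℝ)) + v₁ ⬝ᵥ (Q j *ᵥ v₁) + V x := by
      rw [hV, hVsum, hFsum x, ← hLsum x]
      simp only [mul_add, Finset.sum_add_distrib, ← Finset.sum_mul, hα1, one_mul, dotProduct_sum,
        dotProduct_smul, smul_eq_mul, Finset.mul_sum, mul_left_comm]
    have hQv : Q j *ᵥ v₁ = -F x := by
      rw [hv₁, mulVec_neg, mulVec_mulVec,
        mul_nonsing_inv _ ((isUnit_iff_isUnit_det _).1 (hQ j).isUnit), one_mulVec]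
    have hvF : v₁ ⬝ᵥ F x = -(F x ⬝ᵥ ((Q j)⁻¹ *ᵥ F x)) := by
      rw [hv₁, neg_dotProduct, dotProduct_comm]
    rw [hlin, hQv, dotProduct_neg, dotProduct_zero, hvF] at hsum
    linarith
  have hdec (x) (hx : x ≠ 0) : V (F x) < V x := by
    have h := sum_mul_pos_of_sum_eq_one (fun i => hα0 i (F x)) (hα1 (F x))
      fun j => sub_pos.2 (hstep j x hx)
    rw [hV (F x), hVsum]
    simpa only [mul_sub, Finset.sum_sub_distrib, ← Finset.sum_mul, hα1, one_mul, sub_pos] using h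
  have hF0 : F 0 = 0 := by rw [hF, hZ0, mulVec_zero]
  have hFc : Continuous F := by
    rw [funext hFsum]
    fun_prop
  have hVc : Continuous V := by
    rw [funext hV]
    simp only [hVsum]
    fun_prop
  have hV0 : V 0 = 0 := by rw [hV, zero_dotProduct]
  obtain ⟨c, hc, hcV⟩ : ∃ c > 0, ∀ x, c * ‖x‖ ^ 2 ≤ V x := by
    choose c hc hcQ using fun i => (hQ i).inv.exists_pos_mul_norm_sq_le
    have : Nonempty (Fin N) := ⟨⟨0, hN⟩⟩
    obtain ⟨i₀, hi₀⟩ := Finite.exists_min c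
    refine ⟨c i₀, hc i₀, fun x => ?_⟩
    rw [hV, hVsum]
    calc c i₀ * ‖x‖ ^ 2 = ∑ i, α i x * (c i₀ * ‖x‖ ^ 2) := by rw [← Finset.sum_mul, hα1, one_mul]
      _ ≤ _ := Finset.sum_le_sum fun i _ => mul_le_mul_of_nonneg_left
        ((mul_le_mul_of_nonneg_right (hi₀ i) (sq_nonneg _)).trans (hcQ i x)) (hα0 i x)
  refine ⟨hdec, hF0, fun ε hε => ?_, lyapunov_attractive hc hFc hF0 hVc hV0 hcV hdec⟩
  have hn' : 0 < √(n : ℝ) := Real.sqrt_pos.2 (Nat.cast_pos.2 hn)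
  obtain ⟨r, hr, h⟩ := Metric.eventually_nhds_iff.1
    (lyapunov_stable hc hF0 hVc hV0 hcV hdec (ε / √n) (by positivity))
  refine ⟨r / 2, by positivity, fun x₀ hx₀ k => (enorm10_le _).trans ?_⟩
  rw [← le_div_iff₀' hn']
  refine h ?_ k
  rw [dist_zero_right]
  linarith [norm_le_enorm10 x₀]
end

section
/- Let n, m, S, T, N be positive integers with S > n, and fix δ ∈ ℝ. Let α₁,…,α_N : ℝⁿ → ℝ be continuous with α_i(x) ≥ 0 and Σ_{i=1}^N α_i(x) = 1 for all x ∈ ℝⁿ. Let Z : ℝⁿ → ℝ^S be continuous with Z(0) = 0 and Z(x) = (x, Ẑ(x)) for some Ẑ : ℝⁿ → ℝ^{S−n}. Let 𝓛₁,…,𝓛_N ∈ ℝ^{(S−n)×S}; set L(x) := Σ_{i=1}^N α_i(x) 𝓛_i = [L₁(x) L₂(x)] with L₂(x) ∈ ℝ^{(S−n)×(S−n)}, and assume L(x)·Z(x) = 0 and L₂(x) invertible for every x ∈ ℝⁿ. Let A ∈ ℝ^{n×S}, B ∈ ℝ^{n×m}, and let U₀ ∈ ℝ^{m×T}, Z₀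 ∈ ℝ^{S×T}, X₁ ∈ ℝ^{n×T} satisfy X₁ = A·Z₀ + B·U₀. Suppose there exist matrices R_i ∈ ℝ^{T×S} for i = 1,…,N, a single symmetric positive definite Q ∈ ℝ^{n×n}, M ∈ ℝ^{n×n}, C₁ ∈ ℝ^{(S−n)×n} and an invertible C₂ ∈ ℝ^{(S−n)×(S−n)}, such that: (a) for every i ∈ {1,…,N}, the symmetric (S+n)×(S+n) block matrix with top-left block sym([X₁; 𝓛_i·Z₀]·R_i·blkdiag(δI_n, I_{S−n})) + blkdiag(Q, 0), top-right block [X₁; 𝓛_i·Z₀]·R_i·[I_n; 0] + [δMᵀ; 0], and bottom-right block M + Mᵀ − Q, is positive definite; and (b) Z₀·R_i = [[M, 0],[C₁, C₂]] for every i. Define K_i := U₀·R_i·[[M, 0],[C₁, C₂]]⁻¹, K(x) := Σ_{i=1}^N α_i(x) K_i, F(x) := (A + B·K(x))·Z(x), and V(x) := xᵀ·Q⁻¹·x. Then V(F(x)) < V(x) for every x ≠ 0, and the origin of x_{t+1} = F(x_t) is globally asymptotically stable. -/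
open Matrix Filter

/-- The Euclidean norm of a vector in `ℝⁿ`. -/
noncomputable def enorm11 {n : ℕ} (x : Fin n → ℝ) : ℝ := Real.sqrt (∑ i, x i ^ 2)

theorem sq_le_dotProduct_self {n : ℕ} (x : Fin n → ℝ) (i : Fin n) : x i ^ 2 ≤ x ⬝ᵥ x := by
  rw [sq]
  exact Finset.single_le_sum (f := fun j => x j * x j) (fun j _ => mul_self_nonneg (x j))
    (Finset.mem_univ i)

theorem exists_dotProduct_mulVec_le {n : ℕ} (A : Matrix (Fin n) (Fin n) ℝ) :
    ∃ C > 0, ∀ x : Fin n → ℝ, x ⬝ᵥ (A *ᵥ x) ≤ C * (x ⬝ᵥ x) := by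
  refine ⟨∑ i, ∑ j, |A i j| + 1, by positivity, fun x => ?_⟩
  have h1 : x ⬝ᵥ (A *ᵥ x) ≤ (∑ i, ∑ j, |A i j|) * (x ⬝ᵥ x) := by
    rw [dotProduct, Finset.sum_mul]
    refine Finset.sum_le_sum fun i _ => ?_
    rw [mulVec, dotProduct, Finset.mul_sum, Finset.sum_mul]
    refine Finset.sum_le_sum fun j _ => ?_
    have hi := sq_le_dotProduct_self x i
    have hj := sq_le_dotProduct_self x j
    calc x i * (A i j * x j) ≤ |x i * (A i j * x j)| := le_abs_self _
      _ = |A i j| * (|x i| * |x j|) := by simp only [abs_mul]; ring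
      _ ≤ _ := by
        gcongr
        nlinarith [sq_nonneg (|x i| - |x j|), sq_abs (x i), sq_abs (x j)]
  have h2 : 0 ≤ x ⬝ᵥ x := Finset.sum_nonneg fun j _ => mul_self_nonneg (x j)
  linarith

/-- The Young inequality for the conjugate quadratic forms of `Q` and `Q⁻¹`. -/
theorem Matrix.PosDef.two_mul_dotProduct_le {n : ℕ} {Q : Matrix (Fin n) (Fin n) ℝ}
    (hQ : Q.PosDef) (a x : Fin n → ℝ) :
    2 * (a ⬝ᵥ x) ≤ a ⬝ᵥ (Q *ᵥ a) + x ⬝ᵥ (Q⁻¹ *ᵥ x) := by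
  have hu : IsUnit Q.det := hQ.det_pos.ne'.isUnit
  have h := hQ.posSemidef.dotProduct_mulVec_nonneg (a - Q⁻¹ *ᵥ x)
  have hs : Qᵀ = Q := (conjTranspose_eq_transpose_of_trivial Q).symm.trans hQ.isHermitian
  have e : (Q⁻¹ *ᵥ x) ⬝ᵥ (Q *ᵥ a) = a ⬝ᵥ x := by
    rw [dotProduct_mulVec, ← mulVec_transpose, hs, mulVec_mulVec, Matrix.mul_nonsing_inv _ hu,
      one_mulVec, dotProduct_comm]
  simp only [star_trivial, mulVec_sub, mulVec_mulVec, Matrix.mul_nonsing_inv _ hu, one_mulVec,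
    dotProduct_sub, sub_dotProduct, e] at h
  rw [dotProduct_comm (Q⁻¹ *ᵥ x) x] at h
  linarith

theorem tendsto_iterate_of_lyapunov {E : Type*} [NormedAddCommGroup E] [ProperSpace E]
    {F : E → E} {V : E → ℝ} (hF : Continuous F) (hV : Continuous V) (hV0 : V 0 = 0)
    (hF0 : F 0 = 0) {C : ℝ} (hb : ∀ x, ‖x‖ ^ 2 ≤ C * V x) (hC : 0 < C)
    (hdec : ∀ x, x ≠ 0 → V (F x) < V x) (x₀ : E) :
    Tendsto (fun k => F^[k] x₀) atTop (nhds 0) := by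
  have hnn : ∀ x, 0 ≤ V x := fun x => by
    have := (sq_nonneg ‖x‖).trans (hb x)
    exact nonneg_of_mul_nonneg_right this hC
  have hanti : Antitone fun k => V (F^[k] x₀) := antitone_nat_of_succ_le fun k => by
    rw [Function.iterate_succ_apply']
    by_cases h : F^[k] x₀ = 0
    · rw [h, hF0]
    · exact (hdec _ h).le
  have hlim := tendsto_atTop_ciInf hanti ⟨0, by rintro _ ⟨k, rfl⟩; exact hnn _⟩
  set c := ⨅ k, V (F^[k] x₀)
  have hmem : ∀ k, F^[k] x₀ ∈ Metric.closedBall (0 : E) (√(C * V x₀)) := fun k => by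
    rw [mem_closedBall_zero_iff]
    refine Real.le_sqrt_of_sq_le ((hb _).trans ?_)
    gcongr
    exact hanti (Nat.zero_le k)
  obtain ⟨y, -, φ, hφ, hy⟩ := tendsto_subseq_of_bounded Metric.isBounded_closedBall hmem
  have h1 : V y = c := tendsto_nhds_unique ((hV.tendsto y).comp hy) (hlim.comp hφ.tendsto_atTop)
  have h2 : V (F y) = c := by
    refine tendsto_nhds_unique (((hV.comp hF).tendsto y).comp hy)
      ((hlim.comp ((tendsto_add_atTop_nat 1).comp hφ.tendsto_atTop)).congr fun k => ?_)
    simp [Function.iterate_succ_apply']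
  have hy0 : y = 0 := by
    by_contra h
    exact (hdec y h).ne (h2.trans h1.symm)
  have hc : c = 0 := by rw [← h1, hy0, hV0]
  rw [hc] at hlim
  rw [tendsto_zero_iff_norm_tendsto_zero]
  have h3 : Tendsto (fun k => √(C * V (F^[k] x₀))) atTop (nhds 0) := by
    simpa using (hlim.const_mul C).sqrt
  exact squeeze_zero (fun _ => norm_nonneg _) (fun k => Real.le_sqrt_of_sq_le (hb _)) h3

theorem lmi_quadratic_form_pos {n s : ℕ} {δ : ℝ} {W : Matrix (Fin n ⊕ Fin s) (Fin n ⊕ Fin s) ℝ}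
    {Q M : Matrix (Fin n) (Fin n) ℝ}
    (h : (Matrix.fromBlocks
        ((W * Matrix.fromBlocks (δ • (1 : Matrix (Fin n) (Fin n) ℝ)) 0 0
              (1 : Matrix (Fin s) (Fin s) ℝ)) +
          (W * Matrix.fromBlocks (δ • (1 : Matrix (Fin n) (Fin n) ℝ)) 0 0
              (1 : Matrix (Fin s) (Fin s) ℝ))ᵀ +
          Matrix.fromBlocks Q 0 0 0)
        (W * Matrix.fromRows (1 : Matrix (Fin n) (Fin n) ℝ) (0 : Matrix (Fin s) (Fin n) ℝ) +
          Matrix.fromRows (δ • Mᵀ) (0 : Matrix (Fin s) (Fin n) ℝ))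
        (W * Matrix.fromRows (1 : Matrix (Fin n) (Fin n) ℝ) (0 : Matrix (Fin s) (Fin n) ℝ) +
          Matrix.fromRows (δ • Mᵀ) (0 : Matrix (Fin s) (Fin n) ℝ))ᵀ
        (M + Mᵀ - Q)).PosDef)
    {v w : Fin n → ℝ} (u : Fin s → ℝ) (hv : v ≠ 0 ∨ w ≠ 0) :
    0 < 2 * ((Sum.elim v u ᵥ* W) ⬝ᵥ Sum.elim (δ • v + w) u) + v ⬝ᵥ (Q *ᵥ v)
      + 2 * δ * (w ⬝ᵥ (M *ᵥ v)) + 2 * (w ⬝ᵥ (M *ᵥ w)) - w ⬝ᵥ (Q *ᵥ w) := by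
  have hne : Sum.elim (Sum.elim v u) w ≠ 0 := by
    intro h0
    rcases hv with hv | hv
    · exact hv (funext fun i => by simpa using congrFun h0 (Sum.inl (Sum.inl i)))
    · exact hv (funext fun i => by simpa using congrFun h0 (Sum.inr i))
  have h1 := h.dotProduct_mulVec_pos hne
  have t : ∀ {p q : Type} [Fintype p] [Fintype q] (A : Matrix p q ℝ) (x : q → ℝ) (y : p → ℝ),
      x ⬝ᵥ (Aᵀ *ᵥ y) = y ⬝ᵥ (A *ᵥ x) := fun A x y => by
    rw [mulVec_transpose, dotProduct_comm, dotProduct_mulVec]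
  have e1 : Matrix.fromBlocks (δ • (1 : Matrix (Fin n) (Fin n) ℝ)) 0 0
      (1 : Matrix (Fin s) (Fin s) ℝ) *ᵥ Sum.elim v u = Sum.elim (δ • v) u := by
    simp [fromBlocks_mulVec, smul_mulVec]
  have e2 : Matrix.fromRows (1 : Matrix (Fin n) (Fin n) ℝ) (0 : Matrix (Fin s) (Fin n) ℝ) *ᵥ w
      = Sum.elim w 0 := by
    simp [fromRows_mulVec]
  have e3 : Sum.elim (δ • v + w) u = Sum.elim (δ • v) u + Sum.elim w 0 := by
    ext (i | i) <;> simp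
  rw [star_trivial, fromBlocks_mulVec, sumElim_dotProduct_sumElim] at h1
  simp only [Sum.elim_comp_inl, Sum.elim_comp_inr, add_mulVec, sub_mulVec, dotProduct_add,
    dotProduct_sub, t, ← mulVec_mulVec, e1, e2] at h1
  simp only [fromBlocks_mulVec, fromRows_mulVec, sumElim_dotProduct_sumElim, Sum.elim_comp_inl,
    Sum.elim_comp_inr, zero_mulVec, add_zero, dotProduct_zero, smul_mulVec, dotProduct_smul, t,
    smul_eq_mul] at h1
  rw [e3, dotProduct_add, ← dotProduct_mulVec, ← dotProduct_mulVec]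
  linarith

theorem lyapunov_decrease_of_lmi {n s N : ℕ} {δ : ℝ} {c : Fin N → ℝ} (hc0 : ∀ i, 0 ≤ c i)
    (hc1 : ∑ i, c i = 1) {G : Fin N → Matrix (Fin n) (Fin n ⊕ Fin s) ℝ}
    {𝓛 : Fin N → Matrix (Fin s) (Fin n ⊕ Fin s) ℝ} {Q M : Matrix (Fin n) (Fin n) ℝ}
    {C₁ : Matrix (Fin s) (Fin n) ℝ} {C₂ : Matrix (Fin s) (Fin s) ℝ} (hQ : Q.PosDef)
    {W : Fin N → Matrix (Fin n ⊕ Fin s) (Fin n ⊕ Fin s) ℝ}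
    (hW : ∀ i, W i = Matrix.fromRows (G i) (𝓛 i) * Matrix.fromBlocks M 0 C₁ C₂)
    (h : ∀ i, ∀ v w : Fin n → ℝ, ∀ u : Fin s → ℝ, v ≠ 0 ∨ w ≠ 0 →
      0 < 2 * ((Sum.elim v u ᵥ* W i) ⬝ᵥ Sum.elim (δ • v + w) u) + v ⬝ᵥ (Q *ᵥ v)
        + 2 * δ * (w ⬝ᵥ (M *ᵥ v)) + 2 * (w ⬝ᵥ (M *ᵥ w)) - w ⬝ᵥ (Q *ᵥ w))
    {x : Fin n → ℝ} (hx : x ≠ 0) {z : Fin n ⊕ Fin s → ℝ} (hz : ∀ i, z (Sum.inl i) = x i)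
    (hLz : (∑ i, c i • 𝓛 i) *ᵥ z = 0)
    (hL₂ : IsUnit ((∑ i, c i • 𝓛 i).submatrix id Sum.inr)) {y : Fin n → ℝ}
    (hy : y = (∑ i, c i • G i) *ᵥ z) :
    y ⬝ᵥ (Q⁻¹ *ᵥ y) < x ⬝ᵥ (Q⁻¹ *ᵥ x) := by
  by_cases hy0 : y = 0
  · simpa [hy0] using hQ.inv.dotProduct_mulVec_pos hx
  have hu : IsUnit Q.det := hQ.det_pos.ne'.isUnit
  set L := ∑ i, c i • 𝓛 i with hL
  set G' := ∑ i, c i • G i with hG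
  set v := Q⁻¹ *ᵥ y with hv
  have hQv : Q *ᵥ v = y := by
    rw [hv, mulVec_mulVec, Matrix.mul_nonsing_inv _ hu, one_mulVec]
  have hv0 : v ≠ 0 := by
    intro h0
    rw [h0, mulVec_zero] at hQv
    exact hy0 hQv.symm
  obtain ⟨u, huL⟩ : ∃ u : Fin s → ℝ, u ᵥ* L.submatrix id Sum.inr = -(v ᵥ* G') ∘ Sum.inr :=
    Matrix.vecMul_surjective_iff_isUnit.2 hL₂ _
  set g := Sum.elim v u ᵥ* Matrix.fromRows G' L with hg
  have hg' : g = v ᵥ* G' + u ᵥ* L := by rw [hg, sumElim_vecMul_fromRows]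
  set a := g ∘ Sum.inl with ha
  have hga : g = Sum.elim a 0 := by
    ext (i | i)
    · rfl
    · have := congrFun huL i
      rw [hg']
      simp only [Pi.add_apply, Sum.elim_inr, Pi.zero_apply]
      simp only [Function.comp, Pi.neg_apply] at this
      have e : (u ᵥ* L) (Sum.inr i) = (u ᵥ* L.submatrix id Sum.inr) i := rfl
      rw [e, this]
      ring
  have hax : a ⬝ᵥ x = v ⬝ᵥ y := by
    have h1 : g ⬝ᵥ z = v ⬝ᵥ y := by
      rw [hg', add_dotProduct, ← dotProduct_mulVec, ← dotProduct_mulVec, hLz, ← hy]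
      simp
    rw [← h1, hga]
    simp [dotProduct, hz]
  have hgP : g ᵥ* Matrix.fromBlocks M 0 C₁ C₂ = Sum.elim (a ᵥ* M) 0 := by
    rw [hga, vecMul_fromBlocks]
    simp
  have hsum : ∑ i, c i • W i = Matrix.fromRows G' L * Matrix.fromBlocks M 0 C₁ C₂ := by
    simp only [hW, ← Matrix.smul_mul, ← Finset.sum_mul]
    congr 1
    ext (i | i) j <;> simp [hG, hL, Matrix.sum_apply]
  obtain ⟨j, -, hj⟩ : ∃ j ∈ Finset.univ, 0 < c j :=
    Finset.exists_lt_of_sum_lt (f := fun _ => (0 : ℝ)) (by simp [hc1])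
  set f : Fin N → ℝ := fun i => (Sum.elim v u ᵥ* W i) ⬝ᵥ Sum.elim (δ • v + -a) u with hf
  have hfs : ∑ i, c i * f i = (a ᵥ* M) ⬝ᵥ (δ • v + -a) := by
    have e : ∑ i, c i * f i = (Sum.elim v u ᵥ* ∑ i, c i • W i) ⬝ᵥ Sum.elim (δ • v + -a) u := by
      simp [hf, vecMul_sum, sum_dotProduct, vecMul_smul]
    rw [e, hsum, ← vecMul_vecMul, ← hg, hgP]
    simp
  have hpos := Finset.sum_pos' (s := Finset.univ)
    (fun i _ => mul_nonneg (hc0 i) (h i v (-a) u (Or.inl hv0)).le)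
    ⟨j, Finset.mem_univ j, mul_pos hj (h j v (-a) u (Or.inl hv0))⟩
  have hsplit : ∀ i, c i * (2 * f i + v ⬝ᵥ (Q *ᵥ v) + 2 * δ * (-a ⬝ᵥ (M *ᵥ v))
      + 2 * (-a ⬝ᵥ (M *ᵥ (-a))) - -a ⬝ᵥ (Q *ᵥ (-a))) =
      2 * (c i * f i) + c i * (v ⬝ᵥ (Q *ᵥ v) + 2 * δ * (-a ⬝ᵥ (M *ᵥ v))
      + 2 * (-a ⬝ᵥ (M *ᵥ (-a))) - -a ⬝ᵥ (Q *ᵥ (-a))) := fun i => by ring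
  rw [Finset.sum_congr rfl fun i _ => hsplit i, Finset.sum_add_distrib, ← Finset.mul_sum,
    ← Finset.sum_mul, hc1, hfs, hQv, ← dotProduct_mulVec] at hpos
  simp only [mulVec_add, mulVec_smul, mulVec_neg, dotProduct_add, dotProduct_smul, dotProduct_neg,
    neg_dotProduct, smul_eq_mul] at hpos
  have hY := hQ.two_mul_dotProduct_le a x
  rw [dotProduct_comm y v]
  linarith

/-- Main data-driven stabilization result (Theorem 5 of the paper, global case):
feasibility of the data-dependent LMIs yields a polytopic state-feedback controller
`u = K(x) Z(x)` rendering the origin of `x_{t+1} = (A + B K(x_t)) Z(x_t)` globally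
asymptotically stable, with common quadratic Lyapunov function
`V(x) = xᵀ Q⁻¹ x` (Corollary 1 of the paper).
The index type `Fin n ⊕ Fin s` plays the role of `ℝ^S` with `S = n + s > n`. -/
theorem stmt11 (n m s T N : ℕ) (hn : 0 < n) (hm : 0 < m) (hs : 0 < s) (hT : 0 < T)
    (hN : 0 < N) (δ : ℝ)
    (α : Fin N → (Fin n → ℝ) → ℝ)
    (hαc : ∀ i, Continuous (α i))
    (hα0 : ∀ i x, 0 ≤ α i x) (hα1 : ∀ x, ∑ i, α i x = 1)
    (Z : (Fin n → ℝ) → (Fin n ⊕ Fin s → ℝ))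
    (hZc : Continuous Z) (hZ0 : Z 0 = 0)
    (hZx : ∀ x i, Z x (Sum.inl i) = x i)
    (𝓛 : Fin N → Matrix (Fin s) (Fin n ⊕ Fin s) ℝ)
    (L : (Fin n → ℝ) → Matrix (Fin s) (Fin n ⊕ Fin s) ℝ)
    (hL : ∀ x, L x = ∑ i, α i x • 𝓛 i)
    (hLZ : ∀ x, L x *ᵥ Z x = 0)
    (hL₂ : ∀ x, IsUnit ((L x).submatrix id Sum.inr))
    (A : Matrix (Fin n) (Fin n ⊕ Fin s) ℝ) (B : Matrix (Fin n) (Fin m) ℝ)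
    (U₀ : Matrix (Fin m) (Fin T) ℝ) (Z₀ : Matrix (Fin n ⊕ Fin s) (Fin T) ℝ)
    (X₁ : Matrix (Fin n) (Fin T) ℝ)
    (hdata : X₁ = A * Z₀ + B * U₀)
    (R : Fin N → Matrix (Fin T) (Fin n ⊕ Fin s) ℝ)
    (Q : Matrix (Fin n) (Fin n) ℝ) (hQ : Q.PosDef)
    (M : Matrix (Fin n) (Fin n) ℝ)
    (C₁ : Matrix (Fin s) (Fin n) ℝ) (C₂ : Matrix (Fin s) (Fin s) ℝ)
    (hC₂ : IsUnit C₂)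
    -- (a) the data-dependent LMIs
    (hLMI : ∀ i : Fin N,
      (Matrix.fromBlocks
        ((Matrix.fromRows X₁ (𝓛 i * Z₀) * R i *
            Matrix.fromBlocks (δ • (1 : Matrix (Fin n) (Fin n) ℝ)) 0 0
              (1 : Matrix (Fin s) (Fin s) ℝ)) +
          (Matrix.fromRows X₁ (𝓛 i * Z₀) * R i *
            Matrix.fromBlocks (δ • (1 : Matrix (Fin n) (Fin n) ℝ)) 0 0
              (1 : Matrix (Fin s) (Fin s) ℝ))ᵀ +
          Matrix.fromBlocks Q 0 0 0)
        (Matrix.fromRows X₁ (𝓛 i * Z₀) * R i *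
            Matrix.fromRows (1 : Matrix (Fin n) (Fin n) ℝ) (0 : Matrix (Fin s) (Fin n) ℝ) +
          Matrix.fromRows (δ • Mᵀ) (0 : Matrix (Fin s) (Fin n) ℝ))
        (Matrix.fromRows X₁ (𝓛 i * Z₀) * R i *
            Matrix.fromRows (1 : Matrix (Fin n) (Fin n) ℝ) (0 : Matrix (Fin s) (Fin n) ℝ) +
          Matrix.fromRows (δ • Mᵀ) (0 : Matrix (Fin s) (Fin n) ℝ))ᵀ
        (M + Mᵀ - Q)).PosDef)
    -- (b) the equality constraint
    (hZR : ∀ i, Z₀ * R i = Matrix.fromBlocks M 0 C₁ C₂)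
    -- the controller and the closed loop
    (K : Fin N → Matrix (Fin m) (Fin n ⊕ Fin s) ℝ)
    (hK : ∀ i, K i = U₀ * R i * (Matrix.fromBlocks M 0 C₁ C₂)⁻¹)
    (F : (Fin n → ℝ) → (Fin n → ℝ))
    (hF : ∀ x, F x = (A + B * ∑ i, α i x • K i) *ᵥ Z x)
    (V : (Fin n → ℝ) → ℝ)
    (hV : ∀ x, V x = x ⬝ᵥ (Q⁻¹ *ᵥ x)) :
    (∀ x : Fin n → ℝ, x ≠ 0 → V (F x) < V x) ∧
    F 0 = 0 ∧
    (∀ ε > 0, ∃ δ' > 0, ∀ x₀ : Fin n → ℝ, enorm11 x₀ ≤ δ' →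
      ∀ k : ℕ, enorm11 (F^[k] x₀) ≤ ε) ∧
    (∀ x₀ : Fin n → ℝ, Tendsto (fun k => F^[k] x₀) atTop (nhds 0)) := by
  obtain ⟨C, hC, hCb⟩ := exists_dotProduct_mulVec_le Q
  obtain ⟨D, hD, hDb⟩ := exists_dotProduct_mulVec_le Q⁻¹
  have hlow : ∀ x, x ⬝ᵥ x ≤ C * V x := fun x => by
    have h := hQ.two_mul_dotProduct_le (C⁻¹ • x) x
    have h2 := hCb x
    simp only [mulVec_smul, dotProduct_smul, smul_dotProduct, smul_eq_mul] at h
    rw [← hV] at h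
    have h3 : C⁻¹ * (C⁻¹ * (x ⬝ᵥ (Q *ᵥ x))) ≤ C⁻¹ * (C⁻¹ * (C * (x ⬝ᵥ x))) := by gcongr
    rw [inv_mul_cancel_left₀ hC.ne'] at h3
    have h4 : C⁻¹ * (x ⬝ᵥ x) ≤ V x := by linarith
    rwa [inv_mul_le_iff₀ hC] at h4
  have hZn0 : F 0 = 0 := by rw [hF, hZ0, mulVec_zero]
  have hV0 : V 0 = 0 := by simp [hV]
  have hMU : IsUnit M := by
    rw [← Matrix.mulVec_injective_iff_isUnit]
    refine (injective_iff_map_eq_zero M.mulVecLin).2 fun w hw => ?_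
    rw [mulVecLin_apply] at hw
    by_contra hw0
    have h := lmi_quadratic_form_pos (hLMI ⟨0, hN⟩) (v := 0) 0 (Or.inr hw0)
    have h2 := hQ.posSemidef.dotProduct_mulVec_nonneg w
    rw [star_trivial] at h2
    simp [hw] at h
    linarith
  have hP : IsUnit (Matrix.fromBlocks M 0 C₁ C₂).det :=
    (Matrix.isUnit_iff_isUnit_det _).1 (Matrix.isUnit_fromBlocks_zero₁₂.2 ⟨hMU, hC₂⟩)
  have hW : ∀ i, Matrix.fromRows X₁ (𝓛 i * Z₀) * R i =
      Matrix.fromRows (A + B * K i) (𝓛 i) * Matrix.fromBlocks M 0 C₁ C₂ := fun i => by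
    rw [fromRows_mul, fromRows_mul, Matrix.mul_assoc (𝓛 i), hZR, hdata, Matrix.add_mul,
      Matrix.mul_assoc A, hZR, Matrix.add_mul, hK, Matrix.mul_assoc B, Matrix.mul_assoc B,
      Matrix.nonsing_inv_mul_cancel_right _ _ hP]
  have hdec : ∀ x : Fin n → ℝ, x ≠ 0 → V (F x) < V x := fun x hx => by
    rw [hV, hV]
    refine lyapunov_decrease_of_lmi (fun i => hα0 i x) (hα1 x) hQ hW
      (fun i v w u hvw => lmi_quadratic_form_pos (hLMI i) u hvw) hx (hZx x) (by rw [← hL, hLZ])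
      (by rw [← hL]; exact hL₂ x) ?_
    rw [hF]
    simp only [smul_add, Finset.sum_add_distrib, ← Finset.sum_smul, hα1, one_smul, Matrix.mul_sum,
      Matrix.mul_smul]
  have hdec' : ∀ x, V (F x) ≤ V x := fun x => by
    by_cases hx : x = 0
    · rw [hx, hZn0]
    · exact (hdec x hx).le
  have hFc : Continuous F := by
    rw [funext hF]
    fun_prop
  have hVc : Continuous V := by
    rw [funext hV]
    fun_prop
  have henorm : ∀ x : Fin n → ℝ, enorm11 x = √(x ⬝ᵥ x) := fun x => by
    simp [enorm11, dotProduct, sq]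
  refine ⟨hdec, hZn0, fun ε hε => ⟨ε / √(C * D), by positivity, fun x₀ hx₀ k => ?_⟩, ?_⟩
  · have hk : V (F^[k] x₀) ≤ V x₀ := by
      induction k with
      | zero => exact le_rfl
      | succ k ih =>
        rw [Function.iterate_succ_apply']
        exact (hdec' _).trans ih
    rw [henorm] at hx₀ ⊢
    calc √(F^[k] x₀ ⬝ᵥ F^[k] x₀) ≤ √(C * D * (x₀ ⬝ᵥ x₀)) := by
          refine Real.sqrt_le_sqrt ((hlow _).trans ?_)
          rw [mul_assoc]
          gcongr
          exact hk.trans (by rw [hV]; exact hDb x₀)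
      _ = √(C * D) * √(x₀ ⬝ᵥ x₀) := Real.sqrt_mul (by positivity) _
      _ ≤ √(C * D) * (ε / √(C * D)) := by gcongr
      _ = ε := mul_div_cancel₀ _ (by positivity)
  · refine tendsto_iterate_of_lyapunov hFc hVc hV0 hZn0 (fun x => ?_) hC hdec
    refine le_trans ?_ (hlow x)
    have hnn : 0 ≤ x ⬝ᵥ x := Finset.sum_nonneg fun j _ => mul_self_nonneg (x j)
    rw [← Real.le_sqrt (norm_nonneg _) hnn, pi_norm_le_iff_of_nonneg (Real.sqrt_nonneg _)]
    intro i
    refine Real.le_sqrt_of_sq_le ?_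
    rw [Real.norm_eq_abs, sq_abs]
    exact sq_le_dotProduct_self x i
end

section
/- Let n, m, S, T, N be positive integers. Let Â ∈ ℝ^{n×S}, B ∈ ℝ^{n×m}, D₀ ∈ ℝ^{n×T}, and let U₀ ∈ ℝ^{m×T}, Z₀ ∈ ℝ^{S×T}, Y₁ ∈ ℝ^{n×T} satisfy Y₁ = Â·Z₀ + B·U₀ + D₀. Suppose K_i ∈ ℝ^{m×S} and G_i ∈ ℝ^{T×S}, for i = 1,…,N, satisfy U₀·G_i = K_i and Z₀·G_i = I_S. Let α₁,…,α_N : ℝⁿ → ℝ satisfy α_i(x) ≥ 0 and Σ_{i=1}^N α_i(x) = 1 for every x ∈ ℝⁿ. Then for every x ∈ ℝⁿ, Â + B·(Σ_{i=1}^N α_i(x) K_i) = (Y₁ − D₀)·(Σ_{i=1}^N α_i(x) G_i); consequently, for every function Z : ℝⁿ → ℝ^S and ε : ℝⁿ → ℝⁿ and every x, (Â + B·K(x))·Z(x) + ε(x) = (Y₁ − D₀)·G(x)·Z(x) + ε(x), where K(x) := Σ_i α_i(x) K_i and G(x) := Σ_i α_i(x) G_i. -/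
open Matrix

/-- Data-based representation of the closed-loop system in the presence of
noise/uncertainty `D₀` and neglected nonlinearity `ε`. -/
theorem stmt12 (n m S T N : ℕ) (hn : 0 < n) (hm : 0 < m) (hS : 0 < S) (hT : 0 < T)
    (hN : 0 < N)
    (Ahat : Matrix (Fin n) (Fin S) ℝ) (B : Matrix (Fin n) (Fin m) ℝ)
    (D₀ : Matrix (Fin n) (Fin T) ℝ)
    (U₀ : Matrix (Fin m) (Fin T) ℝ) (Z₀ : Matrix (Fin S) (Fin T) ℝ)
    (Y₁ : Matrix (Fin n) (Fin T) ℝ)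
    (hdata : Y₁ = Ahat * Z₀ + B * U₀ + D₀)
    (K : Fin N → Matrix (Fin m) (Fin S) ℝ) (G : Fin N → Matrix (Fin T) (Fin S) ℝ)
    (hUG : ∀ i, U₀ * G i = K i) (hZG : ∀ i, Z₀ * G i = 1)
    (α : Fin N → (Fin n → ℝ) → ℝ)
    (hα0 : ∀ i x, 0 ≤ α i x) (hα1 : ∀ x, ∑ i, α i x = 1) :
    (∀ x : Fin n → ℝ,
      Ahat + B * (∑ i, α i x • K i) = (Y₁ - D₀) * (∑ i, α i x • G i)) ∧
    (∀ (Z : (Fin n → ℝ) → Fin S → ℝ) (ε : (Fin n → ℝ) → (Fin n → ℝ)) (x : Fin n → ℝ),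
      (Ahat + B * (∑ i, α i x • K i)) *ᵥ Z x + ε x =
        ((Y₁ - D₀) * (∑ i, α i x • G i)) *ᵥ Z x + ε x) := by
  have hU (x : Fin n → ℝ) : U₀ * (∑ i, α i x • G i) = ∑ i, α i x • K i := by
    simp [Matrix.mul_sum, hUG]
  have hZ (x : Fin n → ℝ) : Z₀ * (∑ i, α i x • G i) = 1 := by
    simp [Matrix.mul_sum, hZG, ← Finset.sum_smul, hα1]
  have hclosed (x : Fin n → ℝ) :
      Ahat + B * (∑ i, α i x • K i) = (Y₁ - D₀) * (∑ i, α i x • G i) := by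
    rw [hdata, add_sub_cancel_right, Matrix.add_mul, Matrix.mul_assoc, Matrix.mul_assoc,
      hU, hZ, Matrix.mul_one]
  exact ⟨hclosed, fun Z ε x => by rw [hclosed]⟩
end

section
/- Let p, n, T be positive integers, let Ψ ∈ ℝ^{p×p} be symmetric, let E ∈ ℝ^{p×n}, N ∈ ℝ^{T×p}, let Δ ∈ ℝ^{n×n} be symmetric positive semidefinite, and let λ > 0. Suppose the symmetric (p+T)×(p+T) block matrix [[Ψ − λ·E·Δ·Eᵀ, Nᵀ], [N, λ·I_T]] is positive definite. Then for every D ∈ ℝ^{n×T} with D·Dᵀ ⪯ Δ, the matrix Ψ − E·D·N − Nᵀ·Dᵀ·Eᵀ is positive definite. -/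
open Matrix

/-- Petersen's-lemma robustification step: feasibility of the augmented LMI implies the
nominal LMI for every admissible uncertainty `D` with `D Dᵀ ⪯ Δ`. -/
theorem stmt13 (p n T : ℕ) (hp : 0 < p) (hn : 0 < n) (hT : 0 < T)
    (Ψ : Matrix (Fin p) (Fin p) ℝ) (hΨ : Ψ.IsSymm)
    (E : Matrix (Fin p) (Fin n) ℝ) (Nm : Matrix (Fin T) (Fin p) ℝ)
    (Δ : Matrix (Fin n) (Fin n) ℝ) (hΔ : Δ.PosSemidef)
    (lam : ℝ) (hlam : 0 < lam)
    (h : (Matrix.fromBlocks (Ψ - lam • (E * Δ * Eᵀ)) Nmᵀ Nm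
        (lam • (1 : Matrix (Fin T) (Fin T) ℝ))).PosDef) :
    ∀ D : Matrix (Fin n) (Fin T) ℝ, (Δ - D * Dᵀ).PosSemidef →
      (Ψ - E * D * Nm - Nmᵀ * Dᵀ * Eᵀ).PosDef := by
  intro D hD
  -- Conjugate the augmented matrix by the block column with blocks `1` and `-(Dᵀ * Eᵀ)`.
  let C : Matrix (Fin p ⊕ Fin T) (Fin p) ℝ := fromRows 1 (-(Dᵀ * Eᵀ))
  have hC : Function.Injective C.mulVec := by
    intro x y hxy
    ext i
    simpa [C, fromRows_mulVec] using congrFun hxy (Sum.inl i)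
  have hpos := (h.conjTranspose_mul_mul_same hC).add_posSemidef
    ((hD.mul_mul_conjTranspose_same E).smul hlam.le)
  convert hpos using 1
  simp only [C, conjTranspose_eq_transpose_of_trivial, transpose_fromRows, fromBlocks_mul_fromRows,
    Matrix.mul_assoc, fromCols_mul_fromRows]
  simp only [transpose_one, transpose_neg, transpose_mul, transpose_transpose, Matrix.mul_one,
    Matrix.one_mul, Matrix.mul_neg, Matrix.neg_mul, Matrix.mul_add, Matrix.mul_sub,
    Matrix.sub_mul, Matrix.smul_mul, Matrix.mul_smul, Matrix.mul_assoc, smul_sub, smul_neg]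
  abel
end

section
/- Let n, m, q, S, T be positive integers. Let A ∈ ℝ^{n×S}, B ∈ ℝ^{n×q}, and let U₀ ∈ ℝ^{m×T}, Z₀ ∈ ℝ^{S×T}, W̄₀ ∈ ℝ^{q×T}, X₁ ∈ ℝ^{n×T} satisfy X₁ = A·Z₀ + B·W̄₀. Suppose K ∈ ℝ^{m×S} and G ∈ ℝ^{T×S} satisfy U₀·G = K and Z₀·G = I_S. Then for every matrix W ∈ ℝ^{q×m}, A + B·W·K = (X₁ + B·(W·U₀ − W̄₀))·G. -/
open Matrix

/-- Data-based representation of the closed loop for general input-affine systems: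
`A + B W K = (X₁ + B (W U₀ − W̄₀)) G`. -/
theorem stmt17 (n m q S T : ℕ) (hn : 0 < n) (hm : 0 < m) (hq : 0 < q) (hS : 0 < S)
    (hT : 0 < T)
    (A : Matrix (Fin n) (Fin S) ℝ) (B : Matrix (Fin n) (Fin q) ℝ)
    (U₀ : Matrix (Fin m) (Fin T) ℝ) (Z₀ : Matrix (Fin S) (Fin T) ℝ)
    (Wb₀ : Matrix (Fin q) (Fin T) ℝ) (X₁ : Matrix (Fin n) (Fin T) ℝ)
    (hdata : X₁ = A * Z₀ + B * Wb₀)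
    (K : Matrix (Fin m) (Fin S) ℝ) (G : Matrix (Fin T) (Fin S) ℝ)
    (hUG : U₀ * G = K) (hZG : Z₀ * G = 1) :
    ∀ W : Matrix (Fin q) (Fin m) ℝ,
      A + B * W * K = (X₁ + B * (W * U₀ - Wb₀)) * G := by
  intro W
  have h : X₁ + B * (W * U₀ - Wb₀) = A * Z₀ + B * W * U₀ := by
    rw [hdata, Matrix.mul_sub, Matrix.mul_assoc]
    abel
  rw [h, Matrix.add_mul, Matrix.mul_assoc A, hZG, Matrix.mul_one, Matrix.mul_assoc (B * W), hUG]
end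

section
/- Let n, q, T be positive integers. Let P′, P̄ ∈ ℝ^{n×n} be symmetric positive semidefinite with P′ ⪯ P̄, let B ∈ ℝ^{n×q} with B·Bᵀ ⪯ B̄ for a symmetric positive semidefinite B̄ ∈ ℝ^{n×n}, let X₁ ∈ ℝ^{n×T} and 𝓕 ∈ ℝ^{q×T}. Then for every w ∈ ℝ^T, (X₁·w + B·𝓕·w)ᵀ·P′·(X₁·w + B·𝓕·w) ≤ wᵀ·(2·X₁ᵀ·P̄·X₁ + 2·λ_max(P̄)·λ_max(B̄)·𝓕ᵀ·𝓕)·w, where λ_max(·) denotes the largest eigenvalue of a symmetric matrix. -/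
open Matrix

/-- The Rayleigh quotient bound: the quadratic form of a real symmetric matrix is at most its
largest eigenvalue times the squared Euclidean norm. -/
theorem Matrix.IsHermitian.dotProduct_mulVec_le_iSup_eigenvalues {ι : Type*} [Fintype ι]
    [DecidableEq ι] {A : Matrix ι ι ℝ} (hA : A.IsHermitian) (x : ι → ℝ) :
    x ⬝ᵥ (A *ᵥ x) ≤ (⨆ i, hA.eigenvalues i) * (x ⬝ᵥ x) := by
  set U : Matrix ι ι ℝ := (hA.eigenvectorUnitary).1
  have hUU : U * Uᵀ = 1 := by
    simpa [star_eq_conjTranspose] using Unitary.coe_mul_star_self hA.eigenvectorUnitary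
  have hspec : A = U * diagonal hA.eigenvalues * Uᵀ := by
    have h := hA.spectral_theorem
    rw [Unitary.conjStarAlgAut_apply] at h
    simpa [star_eq_conjTranspose, Function.comp_def] using h
  have hquad : x ⬝ᵥ (A *ᵥ x) = ∑ i, hA.eigenvalues i * ((Uᵀ *ᵥ x) i * (Uᵀ *ᵥ x) i) := by
    conv_lhs => rw [hspec]
    rw [← mulVec_mulVec, ← mulVec_mulVec, dotProduct_mulVec, ← mulVec_transpose]
    simp only [dotProduct, mulVec_diagonal]
    exact Finset.sum_congr rfl fun i _ => by ring
  have hnorm : x ⬝ᵥ x = ∑ i, (Uᵀ *ᵥ x) i * (Uᵀ *ᵥ x) i := by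
    have h : x ⬝ᵥ ((U * Uᵀ) *ᵥ x) = (Uᵀ *ᵥ x) ⬝ᵥ (Uᵀ *ᵥ x) := by
      rw [← mulVec_mulVec, dotProduct_mulVec, ← mulVec_transpose]
    rwa [hUU, one_mulVec] at h
  rw [hquad, hnorm, Finset.mul_sum]
  exact Finset.sum_le_sum fun i _ => mul_le_mul_of_nonneg_right
    (le_ciSup (Set.finite_range hA.eigenvalues).bddAbove i) (mul_self_nonneg _)

theorem Matrix.PosSemidef.iSup_eigenvalues_nonneg {ι : Type*} [Fintype ι]
    [DecidableEq ι] {A : Matrix ι ι ℝ} (hA : A.PosSemidef) : 0 ≤ ⨆ i, hA.1.eigenvalues i :=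
  Real.iSup_nonneg hA.eigenvalues_nonneg

/-- If `Bᵀ` has operator norm squared at most `μ`, then so has `B`. -/
theorem Matrix.mulVec_dotProduct_mulVec_le_of_transpose {ι κ : Type*} [Fintype ι] [Fintype κ]
    {B : Matrix ι κ ℝ} {μ : ℝ} (hμ : 0 ≤ μ)
    (hB : ∀ c : ι → ℝ, (Bᵀ *ᵥ c) ⬝ᵥ (Bᵀ *ᵥ c) ≤ μ * (c ⬝ᵥ c)) (y : κ → ℝ) :
    (B *ᵥ y) ⬝ᵥ (B *ᵥ y) ≤ μ * (y ⬝ᵥ y) := by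
  set c := B *ᵥ y
  have hcc : c ⬝ᵥ c = (Bᵀ *ᵥ c) ⬝ᵥ y := by
    rw [mulVec_transpose, ← dotProduct_mulVec]
  have hle := hB c
  rcases hμ.eq_or_lt with rfl | hpos
  · have hzero : Bᵀ *ᵥ c = 0 := dotProduct_self_eq_zero.mp
      (le_antisymm (by simpa using hle) (by simpa using dotProduct_star_self_nonneg (Bᵀ *ᵥ c)))
    simp [hcc, hzero]
  · have hsq : 0 ≤ (Bᵀ *ᵥ c - μ • y) ⬝ᵥ (Bᵀ *ᵥ c - μ • y) := by
      simpa using dotProduct_star_self_nonneg (Bᵀ *ᵥ c - μ • y)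
    simp only [sub_dotProduct, dotProduct_sub, smul_dotProduct, dotProduct_smul, smul_eq_mul,
      dotProduct_comm y (Bᵀ *ᵥ c), ← hcc] at hsq
    refine le_of_mul_le_mul_left ?_ hpos
    linarith

/-- The quadratic form of a positive semidefinite matrix satisfies
`(a + b)ᵀ A (a + b) ≤ 2 aᵀ A a + 2 bᵀ A b`. -/
theorem Matrix.PosSemidef.dotProduct_mulVec_add_le {ι : Type*} [Fintype ι]
    {A : Matrix ι ι ℝ} (hA : A.PosSemidef) (a b : ι → ℝ) :
    (a + b) ⬝ᵥ (A *ᵥ (a + b)) ≤ 2 * (a ⬝ᵥ (A *ᵥ a)) + 2 * (b ⬝ᵥ (A *ᵥ b)) := by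
  have h := hA.dotProduct_mulVec_nonneg (a - b)
  simp only [star_trivial, mulVec_sub, sub_dotProduct, dotProduct_sub] at h
  simp only [mulVec_add, add_dotProduct, dotProduct_add]
  linarith

/-- Data-driven upper bound on the Lyapunov difference for general input-affine systems:
`(X₁ w + B 𝓕 w)ᵀ P' (X₁ w + B 𝓕 w) ≤ wᵀ (2 X₁ᵀ P̄ X₁ + 2 λmax(P̄) λmax(B̄) 𝓕ᵀ 𝓕) w`. -/
theorem stmt19 (n q T : ℕ) (hn : 0 < n) (hq : 0 < q) (hT : 0 < T)
    (P' Pb : Matrix (Fin n) (Fin n) ℝ)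
    (hP' : P'.PosSemidef) (hPb : Pb.PosSemidef)
    (hPle : (Pb - P').PosSemidef)
    (B : Matrix (Fin n) (Fin q) ℝ) (Bb : Matrix (Fin n) (Fin n) ℝ)
    (hBb : Bb.PosSemidef) (hBle : (Bb - B * Bᵀ).PosSemidef)
    (X₁ : Matrix (Fin n) (Fin T) ℝ) (Fm : Matrix (Fin q) (Fin T) ℝ) :
    ∀ w : Fin T → ℝ,
      (X₁ *ᵥ w + B *ᵥ (Fm *ᵥ w)) ⬝ᵥ (P' *ᵥ (X₁ *ᵥ w + B *ᵥ (Fm *ᵥ w))) ≤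
        w ⬝ᵥ (((2 : ℝ) • (X₁ᵀ * Pb * X₁) +
          (2 * (⨆ i, hPb.1.eigenvalues i) * (⨆ i, hBb.1.eigenvalues i)) •
            (Fmᵀ * Fm)) *ᵥ w) := by
  intro w
  have hPbound := hPle.dotProduct_mulVec_nonneg (X₁ *ᵥ w + B *ᵥ (Fm *ᵥ w))
  rw [star_trivial, sub_mulVec, dotProduct_sub] at hPbound
  have hsplit := hPb.dotProduct_mulVec_add_le (X₁ *ᵥ w) (B *ᵥ (Fm *ᵥ w))
  have hPray := hPb.1.dotProduct_mulVec_le_iSup_eigenvalues (B *ᵥ (Fm *ᵥ w))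
  have hBt (c : Fin n → ℝ) :
      (Bᵀ *ᵥ c) ⬝ᵥ (Bᵀ *ᵥ c) ≤ (⨆ i, hBb.1.eigenvalues i) * (c ⬝ᵥ c) := by
    have h := hBle.dotProduct_mulVec_nonneg c
    rw [star_trivial, sub_mulVec, dotProduct_sub, ← mulVec_mulVec, dotProduct_mulVec c B,
      ← mulVec_transpose] at h
    linarith [hBb.1.dotProduct_mulVec_le_iSup_eigenvalues c]
  have hBnorm := mul_le_mul_of_nonneg_left
    (mulVec_dotProduct_mulVec_le_of_transpose hBb.iSup_eigenvalues_nonneg hBt (Fm *ᵥ w))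
    hPb.iSup_eigenvalues_nonneg
  have hX : w ⬝ᵥ ((X₁ᵀ * Pb * X₁) *ᵥ w) = (X₁ *ᵥ w) ⬝ᵥ (Pb *ᵥ (X₁ *ᵥ w)) := by
    rw [← mulVec_mulVec, ← mulVec_mulVec, dotProduct_mulVec, vecMul_transpose]
  have hF : w ⬝ᵥ ((Fmᵀ * Fm) *ᵥ w) = (Fm *ᵥ w) ⬝ᵥ (Fm *ᵥ w) := by
    rw [← mulVec_mulVec, dotProduct_mulVec, vecMul_transpose]
  rw [add_mulVec, smul_mulVec, smul_mulVec, dotProduct_add, dotProduct_smul, dotProduct_smul,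
    hX, hF, smul_eq_mul, smul_eq_mul]
  linarith
end
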